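/- There is an absolute constant C such that for all integers N ≥ 3, ∑_{N^− < p < N^+} H(D_N(p)) ≤ C · N·(log log N)/(log N), where the sum is over primes p in the interval (N^−, N^+). -/

import Mathlib

open scoped Classical BigOperators

noncomputable section

/-- h(d): the class number of the imaginary quadratic order of discriminant d, counted as the
number of reduced primitive positive definite integral binary quadratic forms (A,B,C)
of discriminant d = B² − 4AC -/
def hClass (d : ℤ) : ℕ :=
  Nat.card {t : ℤ × ℤ × ℤ //
    t.2.1 ^ 2 - 4 * t.1 * t.2.2 = d ∧ 0 < t.1 ∧
    Int.gcd (Int.gcd t.1 t.2.1) t.2.2 = 1 ∧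
    |t.2.1| ≤ t.1 ∧ t.1 ≤ t.2.2 ∧ ((|t.2.1| = t.1 ∨ t.1 = t.2.2) → 0 ≤ t.2.1)}

/-- w(d): the number of units of the imaginary quadratic order of discriminant d -/
def wUnits (d : ℤ) : ℕ := if d = -3 then 6 else if d = -4 then 4 else 2

/-- the Kronecker class number H(D) = ∑_{f² ∣ D, D/f² ≡ 0,1 (4)} h(D/f²)/w(D/f²) -/
def HKr (D : ℤ) : ℝ :=
  ∑ f ∈ (Finset.Icc 1 D.natAbs).filter
      (fun f => (f : ℤ) ^ 2 ∣ D ∧ (D / (f : ℤ) ^ 2 % 4 = 0 ∨ D / (f : ℤ) ^ 2 % 4 = 1)),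
    (hClass (D / (f : ℤ) ^ 2) : ℝ) / (wUnits (D / (f : ℤ) ^ 2) : ℝ)

/-- D_N(p) = (p + 1 − N)² − 4p -/
def DN (N p : ℕ) : ℤ := ((p : ℤ) + 1 - (N : ℤ)) ^ 2 - 4 * (p : ℤ)

/-- the primes in the Hasse interval (N⁻, N⁺) = ((√N − 1)², (√N + 1)²) -/
def primesInHasse (N : ℕ) : Finset ℕ :=
  (Finset.range (4 * N + 5)).filter
    (fun p => p.Prime ∧ (Real.sqrt N - 1) ^ 2 < (p : ℝ) ∧ (p : ℝ) < (Real.sqrt N + 1) ^ 2)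

lemma prod_prime_pow_div_dvd_factorial (n : ℕ) :
    ∏ q ∈ n.primesLE, q ^ (n / q) ∣ n.factorial := by
  apply Finset.prod_dvd_of_isRelPrime
  · intro p hp q hq hpq
    have hp' := (Nat.mem_primesLE.1 hp).2
    have hq' := (Nat.mem_primesLE.1 hq).2
    exact Nat.coprime_iff_isRelPrime.1 (Nat.Coprime.pow _ _ ((Nat.coprime_primes hp' hq').2 hpq))
  · intro q hq
    have hq' := (Nat.mem_primesLE.1 hq).2
    have h := (hq'.pow_dvd_factorial_iff (n := q * (n / q)) (r := n / q) (b := Nat.log q (q * (n/q)) + 1) (by omega)).2 ?_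
    · exact h.trans (Nat.factorial_dvd_factorial (Nat.mul_div_le n q))
    · by_cases h0 : n / q = 0
      · simp [h0]
      · have h1 : 1 ∈ Finset.Ico 1 (Nat.log q (q * (n / q)) + 1) := by
          simp
          exact ⟨Nat.le_mul_of_pos_right _ (Nat.pos_of_ne_zero h0), hq'.one_lt⟩
        refine le_trans ?_ (Finset.single_le_sum (fun i _ => Nat.zero_le (q * (n / q) / q ^ i)) h1)
        simp [Nat.mul_div_cancel_left _ hq'.pos]

lemma sum_log_div_prime_le (n : ℕ) (hn : 1 ≤ n) :
    ∑ q ∈ n.primesLE, Real.log q / q ≤ Real.log n + Real.log 4 := by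
  have hn0 : (0 : ℝ) < n := by exact_mod_cast hn
  have h1 : (∏ q ∈ n.primesLE, (q : ℝ) ^ (n / q)) ≤ (n : ℝ) ^ n := by
    have := (Nat.le_of_dvd n.factorial_pos (prod_prime_pow_div_dvd_factorial n)).trans
      (Nat.factorial_le_pow n)
    exact_mod_cast this
  have hpos : ∀ q ∈ n.primesLE, (0 : ℝ) < q := fun q hq => by
    exact_mod_cast (Nat.mem_primesLE.1 hq).2.pos
  have h2 := Real.log_le_log (Finset.prod_pos fun q hq => pow_pos (hpos q hq) (n / q)) h1
  rw [Real.log_prod (fun q hq => (pow_pos (hpos q hq) (n / q)).ne'), Real.log_pow] at h2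
  simp only [Real.log_pow] at h2
  have h3 := Chebyshev.theta_le_log4_mul_x hn0.le
  rw [Chebyshev.theta_eq_sum_primesLE_log] at h3
  have h4 : n * ∑ q ∈ n.primesLE, Real.log q / q
      ≤ ∑ q ∈ n.primesLE, ((n / q : ℕ) : ℝ) * Real.log q + ∑ q ∈ n.primesLE, Real.log q := by
    rw [Finset.mul_sum, ← Finset.sum_add_distrib]
    apply Finset.sum_le_sum
    intro q hq
    have hl : 0 ≤ Real.log q := Real.log_natCast_nonneg q
    have : (n : ℝ) / q ≤ (n / q : ℕ) + 1 := (Nat.lt_floor_add_one ((n : ℝ) / q)).le.trans (by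
      rw [Nat.floor_div_eq_div])
    calc (n : ℝ) * (Real.log q / q) = (n / q) * Real.log q := by ring
      _ ≤ ((n / q : ℕ) + 1) * Real.log q := by gcongr
      _ = _ := by ring
  have h5 : n * ∑ q ∈ n.primesLE, Real.log q / q ≤ n * (Real.log n + Real.log 4) := by linarith
  exact le_of_mul_le_mul_left h5 hn0

lemma sum_inv_prime_sub_le (n : ℕ) (hn : 2 ≤ n) :
    ∑ q ∈ n.primesLE, (1 : ℝ) / q - (∑ q ∈ n.primesLE, Real.log q / q) / Real.log n
      ≤ Real.log (Real.log n) - Real.log (Real.log 2)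
        + Real.log 4 * (1 / Real.log 2 - 1 / Real.log n) := by
  induction n, hn using Nat.le_induction with
  | base =>
    have : Nat.primesLE 2 = {2} := by decide
    rw [this]
    have : Real.log 2 ≠ 0 := by positivity
    simp
    field_simp
    simp
  | succ n hn ih =>
    have hl : 0 < Real.log n := Real.log_pos (by exact_mod_cast hn)
    have hll : Real.log n < Real.log (n + 1 : ℕ) :=
      Real.log_lt_log (by positivity) (by push_cast; linarith)
    have hl' : 0 < Real.log (n + 1 : ℕ) := hl.trans hll
    have hA := sum_log_div_prime_le n (by omega)
    set A := ∑ q ∈ n.primesLE, Real.log q / q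
    set B := ∑ q ∈ n.primesLE, (1 : ℝ) / q
    have key : ∑ q ∈ (n+1).primesLE, (1 : ℝ) / q
        - (∑ q ∈ (n+1).primesLE, Real.log q / q) / Real.log (n + 1 : ℕ)
        = B - A / Real.log (n + 1 : ℕ) := by
      rw [Nat.primesLE_succ]
      split_ifs with hp
      · rw [Finset.sum_insert (Nat.notMem_primesLE n), Finset.sum_insert (Nat.notMem_primesLE n)]
        field_simp
        ring
      · rfl
    rw [key]
    have h1 : 1 - Real.log n / Real.log (n + 1 : ℕ)
        ≤ Real.log (Real.log (n + 1 : ℕ)) - Real.log (Real.log n) := by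
      have := Real.log_le_sub_one_of_pos (div_pos hl hl')
      rw [Real.log_div hl.ne' hl'.ne'] at this
      linarith
    have h2 : 0 ≤ 1 / Real.log n - 1 / Real.log (n + 1 : ℕ) :=
      sub_nonneg.2 (one_div_le_one_div_of_le hl hll.le)
    have h3 := mul_le_mul_of_nonneg_right hA h2
    have h4 : (Real.log n) * (1 / Real.log n - 1 / Real.log (n + 1 : ℕ))
        = 1 - Real.log n / Real.log (n + 1 : ℕ) := by
      field_simp
    have h5 : A / Real.log n - A / Real.log (n + 1 : ℕ) = A * (1 / Real.log n - 1 / Real.log (n + 1 : ℕ)) := by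
      ring
    linarith

lemma exists_sum_inv_prime_le :
    ∃ C : ℝ, 0 < C ∧ ∀ n : ℕ, 2 ≤ n →
      ∑ q ∈ n.primesLE, (1 : ℝ) / q ≤ Real.log (Real.log n) + C := by
  have hl2 : 0 < Real.log 2 := by positivity
  have hl4 : 0 < Real.log 4 := by positivity
  refine ⟨|1 - Real.log (Real.log 2) + 2 * Real.log 4 / Real.log 2| + 1, by positivity, ?_⟩
  intro n hn
  have h1 := sum_inv_prime_sub_le n hn
  have h2 := sum_log_div_prime_le n (by omega)
  have hl : Real.log 2 ≤ Real.log n := Real.log_le_log (by norm_num) (by exact_mod_cast hn)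
  have hl' : 0 < Real.log n := hl2.trans_le hl
  have h3 : (∑ q ∈ n.primesLE, Real.log q / q) / Real.log n ≤ 1 + Real.log 4 / Real.log 2 := by
    calc _ ≤ (Real.log n + Real.log 4) / Real.log n := by gcongr
      _ = 1 + Real.log 4 / Real.log n := by field_simp
      _ ≤ _ := by gcongr
  have h4 : 0 ≤ Real.log 4 * (1 / Real.log n) := by positivity
  have h5 := le_abs_self (1 - Real.log (Real.log 2) + 2 * Real.log 4 / Real.log 2)
  have h6 : Real.log 4 * (1 / Real.log 2) = Real.log 4 / Real.log 2 := by ring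
  have h7 : 2 * Real.log 4 / Real.log 2 = Real.log 4 / Real.log 2 + Real.log 4 / Real.log 2 := by ring
  linarith

lemma sum_inv_prime_Ioc_le {y X : ℕ} (hy : 2 ≤ y) (hX : 1 ≤ X) :
    ∑ q ∈ X.primesLE with y < q, (1 : ℝ) / q ≤ (Real.log X + Real.log 4) / Real.log y := by
  have hl : 0 < Real.log y := Real.log_pos (by exact_mod_cast hy)
  rw [le_div_iff₀ hl, Finset.sum_mul]
  refine le_trans ?_ (sum_log_div_prime_le X hX)
  refine le_trans ?_ (Finset.sum_le_sum_of_subset_of_nonneg (Finset.filter_subset (fun q => y < q) _)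
    (fun q _ _ => div_nonneg (Real.log_natCast_nonneg q) (Nat.cast_nonneg q)))
  refine Finset.sum_le_sum fun q hq => ?_
  have hq' := (Finset.mem_filter.1 hq).2
  have : Real.log y ≤ Real.log q :=
    Real.log_le_log (by exact_mod_cast (by omega : 0 < y)) (by exact_mod_cast hq'.le)
  rw [div_mul_eq_mul_div, one_mul]
  gcongr

/-- The number of square roots of `D` modulo `n`. -/
def sqrtCount (D : ℤ) (n : ℕ) : ℕ := Nat.card {x : ZMod n // x ^ 2 = (D : ZMod n)}

lemma sqrtCount_one (D : ℤ) : sqrtCount D 1 = 1 := by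
  unfold sqrtCount
  rw [Nat.card_eq_one_iff_unique]
  exact ⟨⟨fun a b => Subtype.ext (Subsingleton.elim _ _)⟩, ⟨⟨0, Subsingleton.elim _ _⟩⟩⟩

lemma sqrtCount_mul (D : ℤ) {m n : ℕ} (h : m.Coprime n) :
    sqrtCount D (m * n) = sqrtCount D m * sqrtCount D n := by
  unfold sqrtCount
  rw [← Nat.card_prod]
  let e := ZMod.chineseRemainder h
  refine Nat.card_congr
    { toFun := fun x => (⟨(e x.1).1, ?_⟩, ⟨(e x.1).2, ?_⟩)
      invFun := fun y => ⟨e.symm (y.1.1, y.2.1), ?_⟩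
      left_inv := ?_
      right_inv := ?_ }
  · have := congrArg (fun z => (e z).1) x.2
    simpa using this
  · have := congrArg (fun z => (e z).2) x.2
    simpa using this
  · apply e.injective
    rw [map_pow, e.apply_symm_apply, map_intCast]
    exact Prod.ext y.1.2 y.2.2
  · intro x
    simp
  · intro y
    simp

lemma sqrtCount_eq_card_filter (D : ℤ) {n : ℕ} (hn : 0 < n) :
    sqrtCount D n = ((Finset.range n).filter fun x : ℕ => (n : ℤ) ∣ (x : ℤ) ^ 2 - D).card := by
  have : NeZero n := ⟨hn.ne'⟩
  unfold sqrtCount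
  rw [Nat.card_eq_fintype_card, Fintype.card_subtype]
  refine Finset.card_bij (fun x _ => x.val) ?_ ?_ ?_
  · intro x hx
    simp only [Finset.mem_filter, Finset.mem_univ, true_and, Finset.mem_range] at hx ⊢
    refine ⟨ZMod.val_lt x, ?_⟩
    rw [← ZMod.intCast_zmod_eq_zero_iff_dvd]
    simp [hx]
  · intro x _ y _ h
    exact ZMod.val_injective n h
  · intro y hy
    simp only [Finset.mem_filter, Finset.mem_univ, true_and, Finset.mem_range] at hy ⊢
    refine ⟨(y : ZMod n), ?_, ZMod.val_cast_of_lt hy.1⟩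
    have := (ZMod.intCast_zmod_eq_zero_iff_dvd ((y : ℤ) ^ 2 - D) n).2 hy.2
    push_cast at this
    exact sub_eq_zero.1 this

lemma card_filter_dvd_sub_le (m M : ℕ) (v : ℤ) :
    ((Finset.range (m * M)).filter fun x : ℕ => (m : ℤ) ∣ (x : ℤ) - v).card ≤ M := by
  conv_rhs => rw [← Finset.card_range M]
  refine Finset.card_le_card_of_injOn (fun x => x / m) ?_ ?_
  · intro x hx
    simp only [Finset.coe_filter, Finset.mem_range, Set.mem_ofPred_eq, Finset.coe_range, Set.mem_Iio] at hx ⊢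
    exact Nat.div_lt_of_lt_mul hx.1
  · intro x hx y hy hxy
    simp only [Finset.coe_filter, Finset.mem_range, Set.mem_ofPred_eq] at hx hy
    have h : (x : ℤ) ≡ y [ZMOD m] := by
      have := dvd_sub hy.2 hx.2
      rw [Int.modEq_iff_dvd]
      simpa using this
    have h' : x % m = y % m := (Int.natCast_modEq_iff.1 h)
    simp only at hxy
    rw [← Nat.div_add_mod x m, ← Nat.div_add_mod y m, hxy, h']

lemma pow_dvd_or_pow_dvd_of_pow_dvd_mul {q k j : ℕ} (hq : q.Prime) (hj : 2 * j ≤ k + 1) {a b : ℤ}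
    (h : ((q ^ k : ℕ) : ℤ) ∣ a * b) : ((q ^ j : ℕ) : ℤ) ∣ a ∨ ((q ^ j : ℕ) : ℤ) ∣ b := by
  rw [Int.natCast_dvd, Int.natAbs_mul, Nat.dvd_mul] at h
  obtain ⟨d₁, d₂, h₁, h₂, h⟩ := h
  obtain ⟨i, hi, rfl⟩ := (Nat.dvd_prime_pow hq).1 (Dvd.intro _ h)
  obtain ⟨l, hl, rfl⟩ := (Nat.dvd_prime_pow hq).1 (Dvd.intro_left _ h)
  rw [← pow_add] at h
  have h := Nat.pow_right_injective hq.two_le h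
  simp only [Int.natCast_dvd]
  rcases le_or_gt j i with hji | hji
  · exact Or.inl ((pow_dvd_pow q hji).trans h₁)
  · exact Or.inr ((pow_dvd_pow q (by omega)).trans h₂)

lemma sqrtCount_le_of_dvd_or_dvd (D : ℤ) {m M : ℕ} (hm : 0 < m) (hM : 0 < M)
    (h : ∀ a b : ℤ, ((m * M : ℕ) : ℤ) ∣ a ^ 2 - D → ((m * M : ℕ) : ℤ) ∣ b ^ 2 - D →
      (m : ℤ) ∣ b - a ∨ (m : ℤ) ∣ b + a) : sqrtCount D (m * M) ≤ 2 * M := by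
  rw [sqrtCount_eq_card_filter D (Nat.mul_pos hm hM)]
  rcases Finset.eq_empty_or_nonempty
    ((Finset.range (m * M)).filter fun x : ℕ => ((m * M : ℕ) : ℤ) ∣ (x : ℤ) ^ 2 - D) with h0 | ⟨x, hx⟩
  · rw [h0]
    simp
  · have hx' := (Finset.mem_filter.1 hx).2
    calc _ ≤ (((Finset.range (m * M)).filter fun y : ℕ => (m : ℤ) ∣ (y : ℤ) - x) ∪
          ((Finset.range (m * M)).filter fun y : ℕ => (m : ℤ) ∣ (y : ℤ) - (-x))).card := by
          apply Finset.card_le_card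
          intro y hy
          obtain ⟨hy1, hy2⟩ := Finset.mem_filter.1 hy
          simp only [Finset.mem_union, Finset.mem_filter, hy1, true_and, sub_neg_eq_add]
          exact h _ _ hx' hy2
      _ ≤ _ := Finset.card_union_le _ _
      _ ≤ M + M := add_le_add (card_filter_dvd_sub_le m M _) (card_filter_dvd_sub_le m M _)
      _ = 2 * M := by ring

lemma sqrtCount_prime_pow_le (D : ℤ) {q : ℕ} (hq : q.Prime) (k : ℕ) :
    sqrtCount D (q ^ k) ≤ 2 * q ^ (k / 2) := by
  have e : q ^ k = q ^ (k - k / 2) * q ^ (k / 2) := by rw [← pow_add]; congr 1; omega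
  rw [e]
  refine sqrtCount_le_of_dvd_or_dvd D (pow_pos hq.pos _) (pow_pos hq.pos _) ?_
  rw [← e]
  intro a b ha hb
  refine pow_dvd_or_pow_dvd_of_pow_dvd_mul hq (by omega) (k := k) ?_
  have e' : (b - a) * (b + a) = b ^ 2 - D - (a ^ 2 - D) := by ring
  rw [e']
  exact dvd_sub hb ha

lemma sqrtCount_prime_le_two (D : ℤ) {q : ℕ} (hq : q.Prime) : sqrtCount D q ≤ 2 := by
  simpa using sqrtCount_prime_pow_le D hq 1

lemma sqrtCount_prime_sq_le_of_dvd {D : ℤ} {q : ℕ} (hq : q.Prime) (h : (q : ℤ) ∣ D) :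
    sqrtCount D (q ^ 2) ≤ q := by
  rw [sqrtCount_eq_card_filter D (pow_pos hq.pos _)]
  refine le_trans (Finset.card_le_card ?_) (card_filter_dvd_sub_le q q 0)
  intro x hx
  rw [← sq]
  obtain ⟨hx1, hx2⟩ := Finset.mem_filter.1 hx
  refine Finset.mem_filter.2 ⟨hx1, ?_⟩
  rw [sub_zero]
  have h1 : (q : ℤ) ∣ (x : ℤ) ^ 2 - D := (Dvd.intro_left ((q : ℤ)) (by push_cast; ring)).trans hx2
  have h2 : (q : ℤ) ∣ (x : ℤ) ^ 2 := by simpa using dvd_add h1 h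
  exact (Nat.prime_iff_prime_int.1 hq).dvd_of_dvd_pow h2

lemma sqrtCount_prime_of_dvd {D : ℤ} {q : ℕ} (hq : q.Prime) (h : (q : ℤ) ∣ D) :
    sqrtCount D q = 1 := by
  have := Fact.mk hq
  unfold sqrtCount
  rw [(ZMod.intCast_zmod_eq_zero_iff_dvd D q).2 h, Nat.card_eq_one_iff_unique]
  refine ⟨⟨fun a b => Subtype.ext ?_⟩, ⟨⟨0, by simp⟩⟩⟩
  rw [pow_eq_zero_iff two_ne_zero |>.1 a.2, pow_eq_zero_iff two_ne_zero |>.1 b.2]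

lemma sqrtCount_prime_sq_le_of_not_dvd {D : ℤ} {q : ℕ} (hq : q.Prime) (hq2 : q ≠ 2)
    (h : ¬ (q : ℤ) ∣ D) : sqrtCount D (q ^ 2) ≤ 2 := by
  have hqi := Nat.prime_iff_prime_int.1 hq
  have := sqrtCount_le_of_dvd_or_dvd D (pow_pos hq.pos 2) (M := 1) one_pos ?_
  · simpa using this
  rw [mul_one]
  intro a b ha hb
  have hab : ((q : ℤ)) ^ 2 ∣ (b - a) * (b + a) := by
    have e' : (b - a) * (b + a) = b ^ 2 - D - (a ^ 2 - D) := by ring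
    rw [e']
    exact_mod_cast dvd_sub hb ha
  push_cast at *
  by_cases h1 : (q : ℤ) ∣ b - a
  · left
    refine hqi.pow_dvd_of_dvd_mul_right 2 ?_ hab
    intro h2
    have h3 : (q : ℤ) ∣ 2 * a := by
      have e' : 2 * a = b + a - (b - a) := by ring
      rw [e']
      exact dvd_sub h2 h1
    rcases hqi.dvd_mul.1 h3 with h4 | h4
    · exact hq2 ((Nat.prime_dvd_prime_iff_eq hq Nat.prime_two).1 (by exact_mod_cast h4))
    · apply h
      have h5 : (q : ℤ) ∣ a ^ 2 - D := (Dvd.intro_left ((q : ℤ)) (by ring)).trans ha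
      have := dvd_sub (h4.pow two_ne_zero) h5
      simpa using this
  · exact Or.inr (hqi.pow_dvd_of_dvd_mul_left 2 h1 hab)

lemma sqrtCount_prime_pow_div_le (D : ℤ) {q : ℕ} (hq : q.Prime) (k : ℕ) :
    (sqrtCount D (q ^ k) : ℝ) / (q ^ k : ℕ) ≤ 2 * (1 / √(q : ℝ)) ^ k := by
  have hq0 : (0 : ℝ) < q := by exact_mod_cast hq.pos
  have hs : 1 ≤ √(q : ℝ) := Real.one_le_sqrt.2 (by exact_mod_cast hq.one_le)
  have h1 : (sqrtCount D (q ^ k) : ℝ) ≤ 2 * (q : ℝ) ^ (k / 2) := by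
    exact_mod_cast sqrtCount_prime_pow_le D hq k
  have h2 : (q : ℝ) ^ (k / 2) ≤ √(q : ℝ) ^ k := by
    calc (q : ℝ) ^ (k / 2) = √(q : ℝ) ^ (2 * (k / 2)) := by
          rw [pow_mul, Real.sq_sqrt hq0.le]
      _ ≤ _ := pow_le_pow_right₀ hs (by omega)
  have h3 : ((q ^ k : ℕ) : ℝ) = √(q : ℝ) ^ k * √(q : ℝ) ^ k := by
    rw [← mul_pow, Real.mul_self_sqrt hq0.le]
    push_cast
    rfl
  have h4 : 0 < √(q : ℝ) ^ k := by positivity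
  rw [div_le_iff₀ (by rw [h3]; positivity), h3, div_pow, one_pow]
  calc (sqrtCount D (q ^ k) : ℝ) ≤ 2 * √(q : ℝ) ^ k := by linarith
    _ = _ := by field_simp

lemma one_div_sqrt_prime_le {q : ℕ} (hq : q.Prime) : 1 / √(q : ℝ) ≤ 5 / 7 := by
  have h2 : (7 / 5 : ℝ) ≤ √(q : ℝ) := by
    apply Real.le_sqrt_of_sq_le
    have : (2 : ℝ) ≤ q := by exact_mod_cast hq.two_le
    norm_num
    linarith
  calc 1 / √(q : ℝ) ≤ 1 / (7 / 5 : ℝ) := by gcongr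
    _ = 5 / 7 := by norm_num

lemma summable_sqrtCount_prime_pow_div (D : ℤ) {q : ℕ} (hq : q.Prime) :
    Summable fun k : ℕ => (sqrtCount D (q ^ k) : ℝ) / (q ^ k : ℕ) := by
  have hs := one_div_sqrt_prime_le hq
  refine Summable.of_nonneg_of_le (fun k => by positivity) (sqrtCount_prime_pow_div_le D hq) ?_
  exact (summable_geometric_of_lt_one (by positivity) (by linarith)).mul_left 2

/-- The first-order weight at a prime `q` in the Euler factor of `∑ sqrtCount D n / n`. -/
def primeWeight (D : ℤ) (q : ℕ) : ℝ := sqrtCount D q + if (q : ℤ) ∣ D then 1 else 0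

lemma primeWeight_nonneg (D : ℤ) (q : ℕ) : 0 ≤ primeWeight D q := by
  unfold primeWeight
  positivity

lemma primeWeight_le_two (D : ℤ) {q : ℕ} (hq : q.Prime) : primeWeight D q ≤ 2 := by
  unfold primeWeight
  split_ifs with h
  · rw [sqrtCount_prime_of_dvd hq h]
    norm_num
  · have : (sqrtCount D q : ℝ) ≤ 2 := by exact_mod_cast sqrtCount_prime_le_two D hq
    linarith

lemma tsum_sqrtCount_prime_pow_div_le (D : ℤ) {q : ℕ} (hq : q.Prime) :
    ∑' k : ℕ, (sqrtCount D (q ^ k) : ℝ) / (q ^ k : ℕ)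
      ≤ 1 + primeWeight D q / q + 16 * (1 / √(q : ℝ)) ^ 3 := by
  have hq0 : (0 : ℝ) < q := by exact_mod_cast hq.pos
  have hs := one_div_sqrt_prime_le hq
  have hs0 : 0 < 1 / √(q : ℝ) := by positivity
  have hs2 : (1 / √(q : ℝ)) ^ 2 = 1 / q := by
    rw [div_pow, Real.sq_sqrt hq0.le, one_pow]
  have hb := sqrtCount_prime_pow_div_le D hq
  set s := 1 / √(q : ℝ)
  have hsum := summable_sqrtCount_prime_pow_div D hq
  rw [← hsum.sum_add_tsum_nat_add 3]
  have htail : ∑' k : ℕ, (sqrtCount D (q ^ (k + 3)) : ℝ) / (q ^ (k + 3) : ℕ) ≤ 8 * s ^ 3 := by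
    have h1 : HasSum (fun k : ℕ => 2 * s ^ 3 * s ^ k) (2 * s ^ 3 * (1 - s)⁻¹) :=
      (hasSum_geometric_of_lt_one hs0.le (by linarith)).mul_left _
    have h2 : ∑' k : ℕ, (sqrtCount D (q ^ (k + 3)) : ℝ) / (q ^ (k + 3) : ℕ)
        ≤ 2 * s ^ 3 * (1 - s)⁻¹ := by
      rw [← h1.tsum_eq]
      refine Summable.tsum_le_tsum (fun k => (hb (k + 3)).trans_eq (by ring))
        ((summable_nat_add_iff 3).2 hsum) h1.summable
    have h3 : (1 - s)⁻¹ ≤ 4 := by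
      rw [inv_le_comm₀ (by linarith) (by norm_num)]
      linarith
    refine h2.trans ?_
    nlinarith [pow_pos hs0 3]
  have hsq : (sqrtCount D (q ^ 2) : ℝ) / (q ^ 2 : ℕ) ≤ (if (q : ℤ) ∣ D then 1 else 0) / q + 8 * s ^ 3 := by
    have hs3 : 0 < s ^ 3 := by positivity
    split_ifs with h
    · have : (sqrtCount D (q ^ 2) : ℝ) ≤ q := by exact_mod_cast sqrtCount_prime_sq_le_of_dvd hq h
      have h2 : (sqrtCount D (q ^ 2) : ℝ) / (q ^ 2 : ℕ) ≤ 1 / q := by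
        push_cast
        rw [div_le_div_iff₀ (by positivity) hq0]
        nlinarith
      linarith
    · by_cases hq2 : q = 2
      · have h2 := hb 2
        have : s = 1 / √2 := by simp [s, hq2]
        have h3 : 1 / 2 ≤ s := by
          rw [this]
          have : √2 ≤ 2 := by
            rw [Real.sqrt_le_left (by norm_num)]
            norm_num
          gcongr
        rw [zero_div, zero_add]
        nlinarith [sq_nonneg s]
      · have : (sqrtCount D (q ^ 2) : ℝ) ≤ 2 := by
          exact_mod_cast sqrtCount_prime_sq_le_of_not_dvd hq hq2 h
        have h2 : (sqrtCount D (q ^ 2) : ℝ) / (q ^ 2 : ℕ) ≤ 2 * s ^ 3 * s := by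
          have : 2 * s ^ 3 * s = 2 / (q ^ 2 : ℕ) := by
            calc 2 * s ^ 3 * s = 2 * (s ^ 2) ^ 2 := by ring
              _ = _ := by rw [hs2]; push_cast; ring
          rw [this]
          gcongr
        rw [zero_div, zero_add]
        nlinarith
  simp only [Finset.sum_range_succ, Finset.sum_range_zero, pow_zero, pow_one, sqrtCount_one]
  unfold primeWeight
  rw [add_div]
  push_cast at *
  linarith

lemma sum_sqrtCount_div_le_exp (D : ℤ) (X : ℕ) :
    ∑ a ∈ Finset.Icc 1 X, (sqrtCount D a : ℝ) / a ≤
      Real.exp (∑ q ∈ X.primesLE, (primeWeight D q / q + 16 * (1 / √(q : ℝ)) ^ 3)) := by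
  have h := (EulerProduct.summable_and_hasSum_smoothNumbers_prod_primesBelow_tsum
    (f := fun a : ℕ => (sqrtCount D a : ℝ) / a) (by simp [sqrtCount_one])
    (fun {m n} hmn => by
      rw [sqrtCount_mul D hmn]
      push_cast
      rw [mul_div_mul_comm])
    (fun hp => (summable_sqrtCount_prime_pow_div D hp).norm) (X + 1)).2
  have h1 : ∑ a ∈ Finset.Icc 1 X, (sqrtCount D a : ℝ) / a ≤
      ∏ p ∈ X.primesLE, ∑' n : ℕ, (sqrtCount D (p ^ n) : ℝ) / (p ^ n : ℕ) := by
    have e : ∑ a ∈ Finset.Icc 1 X, (sqrtCount D a : ℝ) / a =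
        ∑ a ∈ (Finset.Icc 1 X).subtype (· ∈ (X + 1).smoothNumbers), (sqrtCount D a : ℝ) / (a : ℕ) := by
      rw [Finset.sum_subtype_of_mem (f := fun a : ℕ => (sqrtCount D a : ℝ) / a)]
      intro a ha
      rw [Finset.mem_Icc] at ha
      exact Nat.mem_smoothNumbers_of_lt (by omega) (by omega)
    rw [e]
    exact sum_le_hasSum _ (fun a _ => by positivity) h
  refine h1.trans ?_
  rw [Real.exp_sum]
  refine Finset.prod_le_prod (fun q _ => tsum_nonneg fun n => by positivity) fun q hq => ?_
  refine (tsum_sqrtCount_prime_pow_div_le D (Nat.prime_of_mem_primesLE hq)).trans ?_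
  have := Real.add_one_le_exp (primeWeight D q / q + 16 * (1 / √(q : ℝ)) ^ 3)
  linarith

lemma one_div_sqrt_pow_three (n : ℕ) : (1 / √(n : ℝ)) ^ 3 = 1 / (n : ℝ) ^ (3 / 2 : ℝ) := by
  rw [div_pow, one_pow, Real.sqrt_eq_rpow, ← Real.rpow_natCast, ← Real.rpow_mul (Nat.cast_nonneg n)]
  norm_num

lemma summable_one_div_sqrt_pow_three : Summable fun n : ℕ => (1 / √(n : ℝ)) ^ 3 := by
  simp_rw [one_div_sqrt_pow_three]
  exact Real.summable_one_div_nat_rpow.2 (by norm_num)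

lemma summable_log_mul_one_div_sqrt_pow_three :
    Summable fun n : ℕ => Real.log n * (1 / √(n : ℝ)) ^ 3 := by
  have h : Summable fun n : ℕ => 4 * (1 / (n : ℝ) ^ (5 / 4 : ℝ)) :=
    (Real.summable_one_div_nat_rpow.2 (by norm_num)).mul_left 4
  refine Summable.of_nonneg_of_le
    (fun n => mul_nonneg (Real.log_natCast_nonneg n) (by positivity)) (fun n => ?_) h
  rcases Nat.eq_zero_or_pos n with rfl | hn
  · simp
  have hn0 : (0 : ℝ) < n := by exact_mod_cast hn
  rw [one_div_sqrt_pow_three]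
  have h1 := Real.log_le_rpow_div hn0.le (show (0 : ℝ) < 1 / 4 by norm_num)
  have h2 : (n : ℝ) ^ (3 / 2 : ℝ) = (n : ℝ) ^ (1 / 4 : ℝ) * (n : ℝ) ^ (5 / 4 : ℝ) := by
    rw [← Real.rpow_add hn0]
    norm_num
  have h3 : 0 < (n : ℝ) ^ (1 / 4 : ℝ) := Real.rpow_pos_of_pos hn0 _
  have h4 : 0 < (n : ℝ) ^ (5 / 4 : ℝ) := Real.rpow_pos_of_pos hn0 _
  calc _ ≤ (n : ℝ) ^ (1 / 4 : ℝ) / (1 / 4) * (1 / (n : ℝ) ^ (3 / 2 : ℝ)) := by gcongr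
    _ = _ := by
      rw [h2]
      field_simp

lemma summable_mul_geometric_five_sevenths :
    Summable fun k : ℕ => (k : ℝ) * (5 / 7 : ℝ) ^ k := by
  simpa using summable_pow_mul_geometric_of_norm_lt_one 1
    (show ‖(5 / 7 : ℝ)‖ < 1 by rw [Real.norm_eq_abs, abs_of_pos] <;> norm_num)

/-- The sum of `sqrtCount D n * log n` over prime powers `n ≤ Y` with base and exponent at
most `Z`. -/
def primePowSum (D : ℤ) (Z Y : ℕ) : ℝ :=
  ∑ q ∈ Z.primesLE, ∑ k ∈ (Finset.Icc 1 Z).filter (fun k => q ^ k ≤ Y),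
    (sqrtCount D (q ^ k) : ℝ) * (k * Real.log q)

lemma sum_sqrtCount_prime_pow_mul_log_le (D : ℤ) (Z Y : ℕ) {q : ℕ} (hq : q.Prime) :
    ∑ k ∈ (Finset.Icc 1 Z).filter (fun k => q ^ k ≤ Y),
      (sqrtCount D (q ^ k) : ℝ) * (k * Real.log q) ≤
    2 * (if q ≤ Y then Real.log q else 0) +
      4 * (if q ≤ Y.sqrt then Y.sqrt * Real.log q else 0) +
      6 * Y * (∑' k : ℕ, (k : ℝ) * (5 / 7 : ℝ) ^ k) * (Real.log q * (1 / √(q : ℝ)) ^ 3) := by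
  have hl : 0 ≤ Real.log q := Real.log_natCast_nonneg q
  have hs := one_div_sqrt_prime_le hq
  set s := 1 / √(q : ℝ) with hsdef
  have hs0 : 0 ≤ s := by positivity
  have hterm : ∀ k ∈ (Finset.Icc 1 Z).filter (fun k => q ^ k ≤ Y),
      (sqrtCount D (q ^ k) : ℝ) * (k * Real.log q) ≤
      (if k = 1 then 2 * (if q ≤ Y then Real.log q else 0) else 0) +
      (if k = 2 then 4 * (if q ≤ Y.sqrt then Y.sqrt * Real.log q else 0) else 0) +
      6 * Y * (Real.log q * s ^ 3) * ((k : ℝ) * (5 / 7 : ℝ) ^ k) := by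
    intro k hk
    obtain ⟨hk1, hkY⟩ := Finset.mem_filter.1 hk
    have hk1 := (Finset.mem_Icc.1 hk1).1
    have h3 : 0 ≤ 6 * Y * (Real.log q * s ^ 3) * ((k : ℝ) * (5 / 7 : ℝ) ^ k) := by positivity
    rcases lt_or_ge k 3 with hk3 | hk3
    · have hk12 : k = 1 ∨ k = 2 := by omega
      rcases hk12 with rfl | rfl
      · rw [pow_one] at hkY ⊢
        have : (sqrtCount D q : ℝ) ≤ 2 := by exact_mod_cast sqrtCount_prime_le_two D hq
        simp only [hkY, if_true, Nat.cast_one, one_mul, show ¬ (1 : ℕ) = 2 by norm_num, if_false]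
          at h3 ⊢
        nlinarith
      · have hqs : q ≤ Y.sqrt := Nat.le_sqrt'.2 hkY
        have h1 : (sqrtCount D (q ^ 2) : ℝ) ≤ 2 * q := by
          have := sqrtCount_prime_pow_le D hq 2
          simp only [Nat.reduceDiv, pow_one] at this
          exact_mod_cast this
        have h2 : (q : ℝ) ≤ Y.sqrt := by exact_mod_cast hqs
        have h4 : (sqrtCount D (q ^ 2) : ℝ) * ((2 : ℕ) * Real.log q)
            ≤ (2 * Y.sqrt) * ((2 : ℕ) * Real.log q) := by
          gcongr
          linarith
        simp only [hqs, if_true, show ¬ (2 : ℕ) = 1 by norm_num, if_false] at h3 ⊢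
        push_cast at h4 h3 ⊢
        linarith
    · have h1 := sqrtCount_prime_pow_div_le D hq k
      have hqk : (0 : ℝ) < (q ^ k : ℕ) := by exact_mod_cast pow_pos hq.pos k
      rw [div_le_iff₀ hqk, ← hsdef] at h1
      have h2 : ((q ^ k : ℕ) : ℝ) ≤ Y := by exact_mod_cast hkY
      have h4 : s ^ k ≤ s ^ 3 * (3 * (5 / 7 : ℝ) ^ k) := by
        obtain ⟨j, rfl⟩ := Nat.exists_eq_add_of_le hk3
        rw [pow_add, pow_add (5 / 7 : ℝ)]
        have h5 : s ^ j ≤ (5 / 7 : ℝ) ^ j := pow_le_pow_left₀ hs0 hs j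
        have h6 : (0 : ℝ) < (5 / 7 : ℝ) ^ j := by positivity
        gcongr
        nlinarith
      have h5 : (sqrtCount D (q ^ k) : ℝ) ≤ 2 * (s ^ 3 * (3 * (5 / 7 : ℝ) ^ k)) * Y := by
        refine h1.trans ?_
        gcongr
      rw [if_neg (by omega), if_neg (by omega), zero_add, zero_add]
      calc _ ≤ (2 * (s ^ 3 * (3 * (5 / 7 : ℝ) ^ k)) * Y) * (k * Real.log q) := by gcongr
        _ = _ := by ring
  refine (Finset.sum_le_sum hterm).trans ?_
  rw [Finset.sum_add_distrib, Finset.sum_add_distrib, ← Finset.mul_sum]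
  have hY : (0:ℝ) ≤ Y.sqrt := Nat.cast_nonneg _
  refine add_le_add (add_le_add ?_ ?_) ?_
  · rw [Finset.sum_ite_eq']
    split_ifs <;> (try positivity) <;> simp
  · rw [Finset.sum_ite_eq']
    split_ifs <;> (try positivity) <;> simp
  · calc _ ≤ 6 * Y * (Real.log q * s ^ 3) * ∑' k : ℕ, (k : ℝ) * (5 / 7 : ℝ) ^ k := by
          gcongr
          exact summable_mul_geometric_five_sevenths.sum_le_tsum _ (fun k _ => by positivity)
      _ = _ := by ring

lemma sum_primesLE_ite_log_le (Z Y : ℕ) :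
    ∑ q ∈ Z.primesLE, (if q ≤ Y then Real.log q else 0) ≤ Real.log 4 * Y := by
  have h := Chebyshev.theta_le_log4_mul_x (Nat.cast_nonneg (α := ℝ) Y)
  rw [Chebyshev.theta_eq_sum_primesLE_log] at h
  refine le_trans ?_ h
  rw [← Finset.sum_filter]
  refine Finset.sum_le_sum_of_subset_of_nonneg ?_ (fun q _ _ => Real.log_natCast_nonneg q)
  intro q hq
  obtain ⟨h1, h2⟩ := Finset.mem_filter.1 hq
  exact Nat.mem_primesLE.2 ⟨h2, Nat.prime_of_mem_primesLE h1⟩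

lemma exists_primePowSum_le :
    ∃ C : ℝ, 0 < C ∧ ∀ (D : ℤ) (Z Y : ℕ), primePowSum D Z Y ≤ C * Y := by
  set K := ∑' k : ℕ, (k : ℝ) * (5 / 7 : ℝ) ^ k
  have hK : 0 ≤ K := tsum_nonneg fun k => by positivity
  set S := ∑' n : ℕ, Real.log n * (1 / √(n : ℝ)) ^ 3
  have hS : 0 ≤ S := tsum_nonneg fun n => mul_nonneg (Real.log_natCast_nonneg n) (by positivity)
  have hl4 : 0 < Real.log 4 := by positivity
  refine ⟨6 * Real.log 4 + 6 * K * S, by positivity, fun D Z Y => ?_⟩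
  refine (Finset.sum_le_sum fun q hq =>
    sum_sqrtCount_prime_pow_mul_log_le D Z Y (Nat.prime_of_mem_primesLE hq)).trans ?_
  rw [Finset.sum_add_distrib, Finset.sum_add_distrib, ← Finset.mul_sum, ← Finset.mul_sum,
    ← Finset.mul_sum]
  have h1 := sum_primesLE_ite_log_le Z Y
  have h2 : ∑ q ∈ Z.primesLE, (if q ≤ Y.sqrt then (Y.sqrt : ℝ) * Real.log q else 0)
      ≤ Real.log 4 * Y := by
    have h := sum_primesLE_ite_log_le Z Y.sqrt
    have h' : ((Y.sqrt : ℝ)) * Y.sqrt ≤ Y := by exact_mod_cast Nat.sqrt_le Y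
    calc _ = Y.sqrt * ∑ q ∈ Z.primesLE, (if q ≤ Y.sqrt then Real.log q else 0) := by
          rw [Finset.mul_sum]
          refine Finset.sum_congr rfl fun q _ => ?_
          split_ifs <;> simp
      _ ≤ Y.sqrt * (Real.log 4 * Y.sqrt) := by gcongr
      _ = Real.log 4 * (Y.sqrt * Y.sqrt) := by ring
      _ ≤ _ := by gcongr
  have h3 : ∑ q ∈ Z.primesLE, Real.log q * (1 / √(q : ℝ)) ^ 3 ≤ S :=
    summable_log_mul_one_div_sqrt_pow_three.sum_le_tsum _
      (fun n _ => mul_nonneg (Real.log_natCast_nonneg n) (by positivity))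
  have h4 : 6 * Y * K * ∑ q ∈ Z.primesLE, Real.log q * (1 / √(q : ℝ)) ^ 3 ≤ 6 * Y * K * S := by
    gcongr
  linarith

lemma log_eq_sum_primeFactors {a : ℕ} (ha : a ≠ 0) :
    Real.log a = ∑ q ∈ a.primeFactors, (a.factorization q : ℝ) * Real.log q := by
  conv_lhs => rw [← Nat.prod_factorization_pow_eq_self ha]
  rw [Finsupp.prod, Nat.cast_prod, Real.log_prod]
  · simp
  · intro q hq
    have := (Nat.prime_of_mem_primeFactors (by simpa using hq)).ne_zero
    positivity

lemma sum_sqrtCount_mul_log_le (D : ℤ) (X : ℕ) :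
    ∑ a ∈ Finset.Icc 1 X, (sqrtCount D a : ℝ) * Real.log a ≤
      ∑ m ∈ Finset.Icc 1 X, (sqrtCount D m : ℝ) * primePowSum D X (X / m) := by
  set G : ℕ × ℕ × ℕ → ℝ := fun t =>
    (sqrtCount D t.1 : ℝ) * ((sqrtCount D (t.2.1 ^ t.2.2) : ℝ) * (t.2.2 * Real.log t.2.1))
  have hG : ∀ t, 0 ≤ G t := fun t => by
    have := Real.log_natCast_nonneg t.2.1
    positivity
  set T : Finset (ℕ × ℕ × ℕ) :=
    (Finset.Icc 1 X ×ˢ X.primesLE ×ˢ Finset.Icc 1 X).filter fun t => t.2.1 ^ t.2.2 ≤ X / t.1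
  set S : Finset (Σ _ : ℕ, ℕ) := (Finset.Icc 1 X).sigma fun a => a.primeFactors
  set i : (Σ _ : ℕ, ℕ) → ℕ × ℕ × ℕ := fun x =>
    (x.1 / x.2 ^ x.1.factorization x.2, x.2, x.1.factorization x.2)
  have hR : ∑ m ∈ Finset.Icc 1 X, (sqrtCount D m : ℝ) * primePowSum D X (X / m) = ∑ t ∈ T, G t := by
    rw [Finset.sum_filter, Finset.sum_product]
    refine Finset.sum_congr rfl fun m _ => ?_
    rw [primePowSum, Finset.sum_product, Finset.mul_sum]
    refine Finset.sum_congr rfl fun q _ => ?_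
    rw [Finset.sum_filter, Finset.mul_sum]
    refine Finset.sum_congr rfl fun k _ => ?_
    rw [mul_ite, mul_zero]
  have hL : ∑ a ∈ Finset.Icc 1 X, (sqrtCount D a : ℝ) * Real.log a = ∑ x ∈ S, G (i x) := by
    rw [Finset.sum_sigma]
    refine Finset.sum_congr rfl fun a ha => ?_
    have ha0 : a ≠ 0 := by
      have := (Finset.mem_Icc.1 ha).1
      omega
    rw [log_eq_sum_primeFactors ha0, Finset.mul_sum]
    refine Finset.sum_congr rfl fun q hq => ?_
    have hq' := Nat.prime_of_mem_primeFactors hq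
    have hcop : (q ^ a.factorization q).Coprime (a / q ^ a.factorization q) :=
      (Nat.coprime_ordCompl hq' ha0).pow_left _
    have h := sqrtCount_mul D hcop
    rw [Nat.ordProj_mul_ordCompl_eq_self] at h
    rw [h]
    simp only [G, i]
    push_cast
    ring
  have hi : Set.InjOn i S := by
    rintro ⟨a, q⟩ _ ⟨b, p⟩ _ h
    simp only [i, Prod.mk.injEq] at h
    obtain ⟨h1, rfl, h2⟩ := h
    have e : a = b := by
      rw [← Nat.ordProj_mul_ordCompl_eq_self a q, ← Nat.ordProj_mul_ordCompl_eq_self b q, h1, h2]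
    rw [e]
  rw [hL, hR, ← Finset.sum_image (f := G) hi]
  refine Finset.sum_le_sum_of_subset_of_nonneg ?_ (fun t _ _ => hG t)
  intro t ht
  obtain ⟨⟨a, q⟩, hx, rfl⟩ := Finset.mem_image.1 ht
  obtain ⟨ha, hq⟩ := Finset.mem_sigma.1 hx
  simp only at ha hq
  obtain ⟨ha1, haX⟩ := Finset.mem_Icc.1 ha
  have ha0 : a ≠ 0 := by omega
  have hq' := Nat.prime_of_mem_primeFactors hq
  have hqa := Nat.dvd_of_mem_primeFactors hq
  have hv : 0 < a.factorization q := hq'.factorization_pos_of_dvd ha0 hqa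
  have hm : 0 < a / q ^ a.factorization q := Nat.ordCompl_pos q ha0
  have hmul := Nat.ordProj_mul_ordCompl_eq_self a q
  simp only [T, i, Finset.mem_filter, Finset.mem_product, Finset.mem_Icc, Nat.mem_primesLE]
  refine ⟨⟨⟨hm, (Nat.div_le_self _ _).trans haX⟩, ⟨(Nat.le_of_dvd ha1 hqa).trans haX, hq'⟩, hv, ?_⟩, ?_⟩
  · exact ((Nat.factorization_lt q ha0).le).trans haX
  · rw [Nat.le_div_iff_mul_le hm, hmul]
    exact haX

lemma exists_sum_sqrtCount_mul_log_le :
    ∃ C : ℝ, 0 < C ∧ ∀ (D : ℤ) (X : ℕ), 1 ≤ X →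
      (∑ a ∈ Finset.Icc 1 X, (sqrtCount D a : ℝ)) * Real.log X ≤
        C * X * ∑ a ∈ Finset.Icc 1 X, (sqrtCount D a : ℝ) / a := by
  obtain ⟨C, hC, h⟩ := exists_primePowSum_le
  refine ⟨C + 1, by linarith, fun D X hX => ?_⟩
  have h1 : ∑ a ∈ Finset.Icc 1 X, (sqrtCount D a : ℝ) * Real.log a ≤
      ∑ a ∈ Finset.Icc 1 X, C * X * ((sqrtCount D a : ℝ) / a) := by
    refine (sum_sqrtCount_mul_log_le D X).trans (Finset.sum_le_sum fun m hm => ?_)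
    calc (sqrtCount D m : ℝ) * primePowSum D X (X / m)
        ≤ (sqrtCount D m : ℝ) * (C * (X / m : ℕ)) := by
          gcongr
          exact h _ _ _
      _ ≤ (sqrtCount D m : ℝ) * (C * ((X : ℝ) / m)) := by
          gcongr
          exact Nat.cast_div_le
      _ = _ := by ring
  have h2 : ∑ a ∈ Finset.Icc 1 X, (sqrtCount D a : ℝ) * (Real.log X - Real.log a) ≤
      ∑ a ∈ Finset.Icc 1 X, X * ((sqrtCount D a : ℝ) / a) := by
    refine Finset.sum_le_sum fun a ha => ?_
    have ha1 : (0 : ℝ) < a := by exact_mod_cast (Finset.mem_Icc.1 ha).1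
    have hX1 : (0 : ℝ) < X := by exact_mod_cast hX
    calc (sqrtCount D a : ℝ) * (Real.log X - Real.log a)
        ≤ (sqrtCount D a : ℝ) * ((X : ℝ) / a) := by
          gcongr
          rw [← Real.log_div hX1.ne' ha1.ne']
          have := Real.log_le_sub_one_of_pos (div_pos hX1 ha1)
          linarith
      _ = _ := by ring
  rw [← Finset.mul_sum] at h1 h2
  rw [Finset.sum_mul]
  have h3 : ∑ a ∈ Finset.Icc 1 X, (sqrtCount D a : ℝ) * Real.log X =
      ∑ a ∈ Finset.Icc 1 X, (sqrtCount D a : ℝ) * Real.log a +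
      ∑ a ∈ Finset.Icc 1 X, (sqrtCount D a : ℝ) * (Real.log X - Real.log a) := by
    rw [← Finset.sum_add_distrib]
    refine Finset.sum_congr rfl fun a _ => by ring
  rw [h3]
  linarith

lemma card_filter_Icc_dvd_sq_sub_le (D : ℤ) {a : ℕ} (ha : 0 < a) :
    ((Finset.Icc (-(a : ℤ)) a).filter fun b => (a : ℤ) ∣ b ^ 2 - D).card ≤ 3 * sqrtCount D a := by
  rw [sqrtCount_eq_card_filter D ha]
  have ha' : (0 : ℤ) < a := by exact_mod_cast ha
  refine Finset.card_le_mul_card_image_of_maps_to (f := fun b : ℤ => (b % a).toNat) ?_ 3 ?_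
  · intro b hb
    have hb2 := (Finset.mem_filter.1 hb).2
    have h0 := Int.emod_nonneg b ha'.ne'
    have h1 := Int.emod_lt_of_pos b ha'
    refine Finset.mem_filter.2 ⟨Finset.mem_range.2 (by omega), ?_⟩
    rw [Int.toNat_of_nonneg h0]
    have h2 : (a : ℤ) ∣ (b % a) ^ 2 - b ^ 2 :=
      ((Int.mod_modEq b a).pow 2).symm.dvd
    have := dvd_add h2 hb2
    simpa using this
  · intro x hx
    have hxa := Finset.mem_range.1 (Finset.mem_filter.1 hx).1
    refine le_trans (Finset.card_le_card (t := {(x : ℤ) - a, (x : ℤ), (x : ℤ) + a}) ?_) Finset.card_le_three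
    intro b hb
    obtain ⟨hb1, hb2⟩ := Finset.mem_filter.1 hb
    obtain ⟨hb3, hb4⟩ := Finset.mem_Icc.1 (Finset.mem_filter.1 hb1).1
    have h0 := Int.emod_nonneg b ha'.ne'
    have h1 := Int.mul_ediv_add_emod b a
    have h2 : b % a = x := by omega
    rw [h2] at h1
    have hk1 : b / a < 2 := by
      by_contra! h
      nlinarith
    have hk2 : -2 < b / a := by
      by_contra! h
      nlinarith
    simp only [Finset.mem_insert, Finset.mem_singleton]
    have hk : b / a = -1 ∨ b / a = 0 ∨ b / a = 1 := by omega
    rcases hk with hk | hk | hk <;> rw [hk] at h1 <;> omega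

/-- Pairs `(a, b)` of leading coefficients of (possibly imprimitive) forms of discriminant `D`
with `|b| ≤ a ≤ X`. -/
def formPairs (D : ℤ) (X : ℕ) : Finset (ℤ × ℤ) :=
  (Finset.Icc (1 : ℤ) X ×ˢ Finset.Icc (-(X : ℤ)) X).filter fun t =>
    |t.2| ≤ t.1 ∧ 4 * t.1 ∣ t.2 ^ 2 - D

lemma card_formPairs_le (D : ℤ) (X : ℕ) :
    (formPairs D X).card ≤ 3 * ∑ a ∈ Finset.Icc 1 X, sqrtCount D a := by
  rw [Finset.mul_sum]
  have hmaps : ∀ t ∈ formPairs D X, t.1.toNat ∈ Finset.Icc 1 X := by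
    intro t ht
    have h1 := (Finset.mem_product.1 (Finset.mem_filter.1 ht).1).1
    rw [Finset.mem_Icc] at h1 ⊢
    omega
  rw [Finset.card_eq_sum_card_fiberwise hmaps]
  refine Finset.sum_le_sum fun a ha => ?_
  have ha1 := (Finset.mem_Icc.1 ha).1
  refine le_trans ?_ (card_filter_Icc_dvd_sq_sub_le D (by omega : 0 < a))
  have hfst : ∀ t ∈ (formPairs D X).filter (fun t => t.1.toNat = a), t.1 = a := by
    intro t ht
    obtain ⟨ht1, ht2⟩ := Finset.mem_filter.1 ht
    omega
  refine Finset.card_le_card_of_injOn (fun t => t.2) ?_ ?_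
  · intro t ht
    have h1 := hfst t ht
    obtain ⟨ht1, ht2⟩ := Finset.mem_filter.1 (Finset.mem_coe.1 ht)
    obtain ⟨-, h3, h4⟩ := Finset.mem_filter.1 ht1
    rw [h1] at h3 h4
    exact Finset.mem_coe.2 (Finset.mem_filter.2 ⟨Finset.mem_Icc.2 (abs_le.1 h3), (Dvd.intro_left 4 rfl).trans h4⟩)
  · intro t ht u hu h
    exact Prod.ext ((hfst t ht).trans (hfst u hu).symm) h

lemma hClass_le_card_filter_formPairs {D : ℤ} {M : ℕ} (hD : -D ≤ M) {f : ℕ} (hf : 0 < f)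
    (hfD : (f : ℤ) ^ 2 ∣ D) :
    hClass (D / (f : ℤ) ^ 2) ≤ ((formPairs D M.sqrt).filter fun t =>
      Int.gcd (Int.gcd t.1 t.2) ((t.2 ^ 2 - D) / (4 * t.1)) = f).card := by
  have hf' : (0 : ℤ) < f := by exact_mod_cast hf
  obtain ⟨d, rfl⟩ := hfD
  rw [Int.mul_ediv_cancel_left _ (by positivity)]
  unfold hClass
  set F := (formPairs (f ^ 2 * d) M.sqrt).filter fun t =>
      Int.gcd (Int.gcd t.1 t.2) ((t.2 ^ 2 - f ^ 2 * d) / (4 * t.1)) = f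
  have hcard : F.card = Nat.card F := by simp
  rw [hcard]
  refine Nat.card_le_card_of_injective (fun t => (⟨(f * t.1.1, f * t.1.2.1), ?_⟩ : F)) ?_
  · obtain ⟨⟨A, B, C⟩, h1, h2, h3, h4, h5, -⟩ := t
    simp only at *
    have hmul : (f * B) ^ 2 - f ^ 2 * d = 4 * (f * A) * (f * C) := by
      rw [← h1]
      ring
    have hA : 0 < f * A := by positivity
    have hB : |f * B| ≤ f * A := by
      rw [abs_mul, abs_of_pos hf']
      gcongr
    have hAC : f * A ≤ f * C := by gcongr
    have hsq : (f * B) ^ 2 ≤ (f * A) ^ 2 := sq_le_sq' (abs_le.1 hB).1 (abs_le.1 hB).2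
    have hAM : (f * A) ^ 2 ≤ M := by nlinarith
    have hle : f * A ≤ M.sqrt := by
      have h6 : (f * A).toNat ≤ M.sqrt := by
        rw [Nat.le_sqrt']
        zify
        rw [Int.toNat_of_nonneg hA.le]
        exact hAM
      omega
    have habs := abs_le.1 hB
    refine Finset.mem_filter.2 ⟨Finset.mem_filter.2 ⟨Finset.mem_product.2
      ⟨Finset.mem_Icc.2 ⟨hA, hle⟩, Finset.mem_Icc.2 ⟨by simp only; omega, by simp only; omega⟩⟩, hB, ?_⟩, ?_⟩
    · simp only
      rw [hmul]
      exact Dvd.intro _ rfl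
    · simp only
      rw [hmul, Int.mul_ediv_cancel_left _ (by positivity), Int.gcd_mul_left, Int.natAbs_natCast]
      push_cast
      rw [Int.gcd_mul_left, h3]
      simp
  · intro t u h
    have e1 : t.1.1 = u.1.1 := mul_left_cancel₀ hf'.ne' (congrArg (fun s : F => s.1.1) h)
    have e2 : t.1.2.1 = u.1.2.1 := mul_left_cancel₀ hf'.ne' (congrArg (fun s : F => s.1.2) h)
    clear h
    obtain ⟨⟨A, B, C⟩, h1, h2, _⟩ := t
    obtain ⟨⟨A', B', C'⟩, h1', h2', _⟩ := u
    simp only at h1 h1' h2 e1 e2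
    subst e1 e2
    have e3 : 4 * A * C = 4 * A * C' := by linarith
    have e4 : C = C' := mul_left_cancel₀ (by positivity) e3
    rw [Subtype.mk.injEq, e4]

lemma HKr_le_sum_sqrtCount {D : ℤ} {M : ℕ} (hD : -D ≤ M) :
    HKr D ≤ 3 * ∑ a ∈ Finset.Icc 1 M.sqrt, (sqrtCount D a : ℝ) := by
  obtain ⟨F, hF, h0⟩ : ∃ F : Finset ℤ, (∀ f ∈ F, f ^ 2 ∣ D ∧ ∃ a : ℕ, 0 < a ∧ (a : ℤ) = f) ∧
      HKr D = ∑ f ∈ F, (hClass (D / f ^ 2) : ℝ) / (wUnits (D / f ^ 2) : ℝ) := by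
    refine ⟨_, ?_, rfl⟩
    intro f hf
    obtain ⟨hf1, hf2, -⟩ := Finset.mem_filter.1 hf
    obtain ⟨a, ha1, ha2⟩ := (@Finset.mem_sup _ _ (fun a b => Classical.propDecidable (a = b)) _ _ _).1 hf1
    exact ⟨hf2, a, (Finset.mem_Icc.1 ha1).1, (Finset.mem_singleton.1 ha2).symm⟩
  have h1 : HKr D ≤ ∑ f ∈ F, (hClass (D / f ^ 2) : ℝ) := by
    rw [h0]
    refine Finset.sum_le_sum fun f _ => ?_
    refine div_le_self (by positivity : (0 : ℝ) ≤ (hClass (D / f ^ 2) : ℝ)) ?_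
    unfold wUnits
    split_ifs <;> norm_num
  have h2 : ∑ f ∈ F, hClass (D / f ^ 2) ≤ (formPairs D M.sqrt).card := by
    refine le_trans (Finset.sum_le_sum fun f hf => ?_)
      ((Finset.sum_card_fiberwise_eq_card_filter (formPairs D M.sqrt) F (fun t : ℤ × ℤ =>
        (Int.gcd (Int.gcd t.1 t.2) ((t.2 ^ 2 - D) / (4 * t.1)) : ℤ))).trans_le
        (Finset.card_filter_le _ _))
    obtain ⟨hf2, a, ha, rfl⟩ := hF f hf
    simpa only [Nat.cast_inj] using hClass_le_card_filter_formPairs hD ha hf2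
  have h3 := h2.trans (card_formPairs_le D M.sqrt)
  refine h1.trans ?_
  exact_mod_cast h3

lemma card_sq_sub_sq_eq {q : ℕ} [Fact q.Prime] (hq2 : q ≠ 2) {c : ZMod q} (hc : c ≠ 0) :
    Fintype.card {s : ZMod q × ZMod q // s.2 ^ 2 = s.1 ^ 2 - c} = q - 1 := by
  have h2 : (2 : ZMod q) ≠ 0 := by
    have := ZMod.prime_ne_zero q 2 hq2
    exact_mod_cast this
  rw [← ZMod.card_units q]
  refine Fintype.card_congr
    { toFun := fun s => Units.mk0 (s.1.1 - s.1.2) ?_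
      invFun := fun u => ⟨((u + c * (u⁻¹ : (ZMod q)ˣ)) / 2, (c * (u⁻¹ : (ZMod q)ˣ) - u) / 2), ?_⟩
      left_inv := ?_
      right_inv := ?_ }
  · intro h
    have := s.2
    rw [sub_eq_zero.1 h] at this
    exact hc (by linear_combination this)
  · have : (u : ZMod q) * (u⁻¹ : (ZMod q)ˣ) = 1 := u.mul_inv
    simp only
    field_simp
    linear_combination (-4 * c) * this
  · rintro ⟨⟨s, x⟩, h⟩
    simp only at h
    have h3 : s - x ≠ 0 := by
      intro h'
      rw [sub_eq_zero.1 h'] at h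
      exact hc (by linear_combination h)
    have h4 : c * (s - x)⁻¹ = s + x := by
      field_simp
      linear_combination h
    simp only [Units.val_mk0, Units.val_inv_eq_inv_val, h4, Subtype.mk.injEq, Prod.mk.injEq]
    constructor <;> field_simp <;> ring
  · intro u
    ext
    simp only [Units.val_mk0]
    field_simp
    ring

/-- The deviation from the mean of the number of square roots of `t² - c` modulo `q`. -/
def sqrtDev (c : ℤ) (q : ℕ) (t : ZMod q) : ℝ :=
  (Nat.card {x : ZMod q // x ^ 2 = t ^ 2 - (c : ZMod q)} : ℝ) - 1

lemma sqrtDev_intCast (c : ℤ) (q : ℕ) (t : ℤ) :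
    sqrtDev c q (t : ZMod q) = (sqrtCount (t ^ 2 - c) q : ℝ) - 1 := by
  unfold sqrtDev sqrtCount
  push_cast
  rfl

lemma abs_sqrtDev_le_one (c : ℤ) {q : ℕ} (hq : q.Prime) (t : ZMod q) : |sqrtDev c q t| ≤ 1 := by
  have : NeZero q := ⟨hq.ne_zero⟩
  obtain ⟨s, rfl⟩ := ZMod.intCast_surjective t
  rw [sqrtDev_intCast]
  have h : (sqrtCount (s ^ 2 - c) q : ℝ) ≤ 2 := by exact_mod_cast sqrtCount_prime_le_two _ hq
  have h0 : (0 : ℝ) ≤ (sqrtCount (s ^ 2 - c) q : ℝ) := by positivity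
  rw [abs_le]
  constructor <;> linarith

lemma sum_sqrtDev {c : ℤ} {q : ℕ} [Fact q.Prime] (hq2 : q ≠ 2) (hc : (c : ZMod q) ≠ 0) :
    ∑ t : ZMod q, sqrtDev c q t = -1 := by
  unfold sqrtDev
  rw [Finset.sum_sub_distrib]
  have h : ∑ t : ZMod q, Nat.card {x : ZMod q // x ^ 2 = t ^ 2 - (c : ZMod q)} = q - 1 := by
    rw [← card_sq_sub_sq_eq hq2 hc]
    simp only [Nat.card_eq_fintype_card]
    rw [← Fintype.card_sigma]
    exact Fintype.card_congr
      { toFun := fun s => ⟨(s.1, s.2.1), s.2.2⟩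
        invFun := fun s => ⟨s.1.1, s.1.2, s.2⟩
        left_inv := fun _ => rfl
        right_inv := fun _ => rfl }
  have h1 : 1 ≤ q := (Fact.out : q.Prime).one_le
  rw [← Nat.cast_sum, h]
  simp [Nat.cast_sub h1]

lemma sum_sqrtDev_mul_sqrtDev {c : ℤ} {p q : ℕ} [Fact p.Prime] [Fact q.Prime] (hpq : p ≠ q)
    [NeZero (p * q)] (hp2 : p ≠ 2) (hq2 : q ≠ 2) (hcp : (c : ZMod p) ≠ 0)
    (hcq : (c : ZMod q) ≠ 0) :
    ∑ t : ZMod (p * q), sqrtDev c p (t.cast) * sqrtDev c q (t.cast) = 1 := by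
  have hco : p.Coprime q := (Nat.coprime_primes Fact.out Fact.out).2 hpq
  have h : ∑ s : ZMod p × ZMod q, sqrtDev c p s.1 * sqrtDev c q s.2 = 1 := by
    rw [Fintype.sum_prod_type, ← Finset.sum_mul_sum, sum_sqrtDev hp2 hcp, sum_sqrtDev hq2 hcq]
    norm_num
  rw [← h]
  refine Fintype.sum_equiv (ZMod.chineseRemainder hco).toEquiv _ _ fun t => ?_
  have : (ZMod.chineseRemainder hco) t = (t.cast : ZMod p × ZMod q) := rfl
  simp [this]

lemma abs_sum_range_periodic_le {m : ℕ} [NeZero m] (f : ZMod m → ℝ) (h1 : ∀ t, |f t| ≤ 1)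
    (hs : |∑ t, f t| ≤ 1) (a : ℤ) (T : ℕ) :
    |∑ i ∈ Finset.range T, f ((a + i : ℤ) : ZMod m)| ≤ (T : ℝ) / m + m := by
  have hm : 0 < m := Nat.pos_of_ne_zero (NeZero.ne m)
  have hm' : (0 : ℝ) < m := by exact_mod_cast hm
  induction T using Nat.strong_induction_on generalizing a with
  | _ T ih =>
    by_cases hT : T < m
    · refine (Finset.abs_sum_le_sum_abs _ _).trans ((Finset.sum_le_sum fun i _ => h1 _).trans ?_)
      have : (T : ℝ) ≤ m := by exact_mod_cast hT.le
      have h3 : (0 : ℝ) ≤ (T : ℝ) / m := by positivity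
      simp
      linarith
    · obtain ⟨S, rfl⟩ := Nat.exists_eq_add_of_le (not_lt.1 hT)
      rw [Finset.sum_range_add]
      have hfull : ∑ i ∈ Finset.range m, f ((a + i : ℤ) : ZMod m) = ∑ t, f t := by
        rw [← Equiv.sum_comp (Equiv.addLeft (a : ZMod m)) f]
        refine Finset.sum_bij' (fun i _ => (i : ZMod m)) (fun t _ => t.val) ?_ ?_ ?_ ?_ ?_
        · simp
        · intro t _
          exact Finset.mem_range.2 (ZMod.val_lt t)
        · intro i hi
          exact ZMod.val_cast_of_lt (Finset.mem_range.1 hi)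
        · intro t _
          simp
        · intro i _
          simp
      have hrest : ∑ i ∈ Finset.range S, f ((a + (m + i : ℕ) : ℤ) : ZMod m)
          = ∑ i ∈ Finset.range S, f ((a + i : ℤ) : ZMod m) := by
        refine Finset.sum_congr rfl fun i _ => ?_
        congr 1
        push_cast
        simp
      rw [hfull, hrest]
      refine (abs_add_le _ _).trans ?_
      have := ih S (by omega) a
      push_cast at this ⊢
      rw [add_div, div_self hm'.ne']
      linarith

lemma sum_one_div_sq_le {z : ℕ} (hz : 1 ≤ z) (Q : Finset ℕ) (hQ : ∀ q ∈ Q, z < q) :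
    ∑ q ∈ Q, 1 / (q : ℝ) ^ 2 ≤ 1 / (z : ℝ) := by
  have h1 : ∀ n : ℕ, ∑ q ∈ Finset.Ioc z (z + n), 1 / (q : ℝ) ^ 2 ≤ 1 / (z : ℝ) - 1 / (z + n : ℕ) := by
    intro n
    induction n with
    | zero => simp
    | succ n ih =>
      rw [← add_assoc, Finset.sum_Ioc_succ_top (by omega)]
      have hz' : (0 : ℝ) < z := by exact_mod_cast hz
      have h2 : 1 / ((z + n + 1 : ℕ) : ℝ) ^ 2 ≤ 1 / ((z + n : ℕ) : ℝ) - 1 / ((z + n + 1 : ℕ) : ℝ) := by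
        push_cast
        have h3 : (0 : ℝ) < z + n := by positivity
        rw [div_sub_div _ _ h3.ne' (by positivity), div_le_div_iff₀ (by positivity) (by positivity)]
        nlinarith
      linarith
  have hsub : Q ⊆ Finset.Ioc z (z + Q.sup id) := by
    intro q hq
    have : q ≤ Q.sup id := Finset.le_sup (f := id) hq
    exact Finset.mem_Ioc.2 ⟨hQ q hq, by omega⟩
  refine (Finset.sum_le_sum_of_subset_of_nonneg hsub fun _ _ _ => by positivity).trans
    ((h1 _).trans ?_)
  have : (0 : ℝ) ≤ 1 / ((z + Q.sup id : ℕ) : ℝ) := by positivity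
  linarith

lemma abs_sum_sqrtDev_mul_le {c : ℤ} {p q : ℕ} (hp : p.Prime) (hq : q.Prime) (hpq : p ≠ q)
    (hp2 : p ≠ 2) (hq2 : q ≠ 2) (hcp : ¬ (p : ℤ) ∣ c) (hcq : ¬ (q : ℤ) ∣ c) (a : ℤ) (T : ℕ) :
    |∑ i ∈ Finset.range T, sqrtDev c p ((a + i : ℤ) : ZMod p) * sqrtDev c q ((a + i : ℤ) : ZMod q)|
      ≤ (T : ℝ) / (p * q) + p * q := by
  have : Fact p.Prime := ⟨hp⟩
  have : Fact q.Prime := ⟨hq⟩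
  have : NeZero (p * q) := ⟨(Nat.mul_pos hp.pos hq.pos).ne'⟩
  have hp0 : (c : ZMod p) ≠ 0 := fun h => hcp ((ZMod.intCast_zmod_eq_zero_iff_dvd c p).1 h)
  have hq0 : (c : ZMod q) ≠ 0 := fun h => hcq ((ZMod.intCast_zmod_eq_zero_iff_dvd c q).1 h)
  have h := abs_sum_range_periodic_le (m := p * q)
    (fun t => sqrtDev c p (t.cast) * sqrtDev c q (t.cast)) (fun t => ?_) ?_ a T
  · have e1 : ∀ s : ℤ, ((s : ZMod (p * q)).cast : ZMod p) = s :=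
      fun s => ZMod.cast_intCast (Dvd.intro _ rfl) s
    have e2 : ∀ s : ℤ, ((s : ZMod (p * q)).cast : ZMod q) = s :=
      fun s => ZMod.cast_intCast (Dvd.intro_left _ rfl) s
    simp only [e1, e2, Nat.cast_mul] at h
    exact h
  · rw [abs_mul]
    exact mul_le_one₀ (abs_sqrtDev_le_one c hp _) (abs_nonneg _) (abs_sqrtDev_le_one c hq _)
  · rw [sum_sqrtDev_mul_sqrtDev hpq hp2 hq2 hp0 hq0]
    simp

lemma sum_sq_sum_sqrtDev_div_le {c : ℤ} {z y : ℕ} (hz : 1 ≤ z) {Q : Finset ℕ}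
    (hQ : ∀ q ∈ Q, q.Prime ∧ q ≠ 2 ∧ ¬ (q : ℤ) ∣ c ∧ z < q ∧ q ≤ y) (a : ℤ) (T : ℕ) :
    ∑ i ∈ Finset.range T, (∑ q ∈ Q, sqrtDev c q ((a + i : ℤ) : ZMod q) / q) ^ 2
      ≤ 2 * T / z + (y : ℝ) ^ 2 := by
  have hz' : (1 : ℝ) ≤ z := by exact_mod_cast hz
  have hsq : ∑ q ∈ Q, 1 / (q : ℝ) ^ 2 ≤ 1 / (z : ℝ) := sum_one_div_sq_le hz Q fun q hq => (hQ q hq).2.2.2.1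
  have hcardQ : (Q.card : ℝ) ≤ y := by
    have : Q ⊆ Finset.Ioc 0 y := fun q hq =>
      Finset.mem_Ioc.2 ⟨(hQ q hq).1.pos, (hQ q hq).2.2.2.2⟩
    have := Finset.card_le_card this
    rw [Nat.card_Ioc] at this
    exact_mod_cast this
  have hexp : ∑ i ∈ Finset.range T, (∑ q ∈ Q, sqrtDev c q ((a + i : ℤ) : ZMod q) / q) ^ 2
      = ∑ p ∈ Q, ∑ q ∈ Q, 1 / ((p : ℝ) * q) * ∑ i ∈ Finset.range T,
          sqrtDev c p ((a + i : ℤ) : ZMod p) * sqrtDev c q ((a + i : ℤ) : ZMod q) := by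
    have h1 : ∀ i : ℕ, (∑ q ∈ Q, sqrtDev c q ((a + i : ℤ) : ZMod q) / q) ^ 2
        = ∑ p ∈ Q, ∑ q ∈ Q, 1 / ((p : ℝ) * q) *
          (sqrtDev c p ((a + i : ℤ) : ZMod p) * sqrtDev c q ((a + i : ℤ) : ZMod q)) := by
      intro i
      rw [sq, Finset.sum_mul_sum]
      refine Finset.sum_congr rfl fun p _ => Finset.sum_congr rfl fun q _ => ?_
      rw [div_mul_div_comm]
      ring
    simp only [h1, Finset.mul_sum]
    rw [Finset.sum_comm]
    exact Finset.sum_congr rfl fun p _ => Finset.sum_comm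
  have hterm : ∀ p ∈ Q, ∀ q ∈ Q, 1 / ((p : ℝ) * q) * ∑ i ∈ Finset.range T,
      sqrtDev c p ((a + i : ℤ) : ZMod p) * sqrtDev c q ((a + i : ℤ) : ZMod q)
      ≤ (if p = q then T / (p : ℝ) ^ 2 else 0) + (T * (1 / (p : ℝ) ^ 2 * (1 / (q : ℝ) ^ 2)) + 1) := by
    intro p hp q hq
    obtain ⟨hp1, hp2, hpc, -, -⟩ := hQ p hp
    obtain ⟨hq1, hq2, hqc, -, -⟩ := hQ q hq
    have hp0 : (0 : ℝ) < p := by exact_mod_cast hp1.pos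
    have hq0 : (0 : ℝ) < q := by exact_mod_cast hq1.pos
    by_cases hpq : p = q
    · subst hpq
      rw [if_pos rfl]
      have h1 : ∑ i ∈ Finset.range T,
          sqrtDev c p ((a + i : ℤ) : ZMod p) * sqrtDev c p ((a + i : ℤ) : ZMod p) ≤ T := by
        refine (Finset.sum_le_sum (g := fun _ => (1 : ℝ)) fun i _ => ?_).trans (by simp)
        rw [← abs_mul_abs_self]
        exact mul_le_one₀ (abs_sqrtDev_le_one c hp1 _) (abs_nonneg _) (abs_sqrtDev_le_one c hp1 _)
      have h2 : 1 / ((p : ℝ) * p) * ∑ i ∈ Finset.range T,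
          sqrtDev c p ((a + i : ℤ) : ZMod p) * sqrtDev c p ((a + i : ℤ) : ZMod p)
          ≤ 1 / ((p : ℝ) * p) * T := by gcongr
      have h3 : 1 / ((p : ℝ) * p) * T = T / (p : ℝ) ^ 2 := by
        field_simp
      have h4 : (0 : ℝ) ≤ T * (1 / (p : ℝ) ^ 2 * (1 / (p : ℝ) ^ 2)) + 1 := by positivity
      linarith
    · rw [if_neg hpq, zero_add]
      have h1 := (le_abs_self _).trans
        (abs_sum_sqrtDev_mul_le hp1 hq1 hpq hp2 hq2 hpc hqc a T)
      calc _ ≤ 1 / ((p : ℝ) * q) * ((T : ℝ) / (p * q) + p * q) := by gcongr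
        _ = _ := by field_simp
  rw [hexp]
  refine (Finset.sum_le_sum fun p hp => Finset.sum_le_sum fun q hq => hterm p hp q hq).trans ?_
  simp only [Finset.sum_add_distrib, Finset.sum_const, nsmul_eq_mul, mul_one, ← Finset.mul_sum,
    ← Finset.sum_mul, Finset.sum_ite_eq]
  rw [Finset.sum_congr rfl (g := fun q : ℕ => (T : ℝ) * (1 / (q : ℝ) ^ 2))
    (fun q hq => by rw [if_pos hq]; ring), ← Finset.mul_sum]
  have hnn : 0 ≤ ∑ q ∈ Q, 1 / (q : ℝ) ^ 2 := Finset.sum_nonneg fun _ _ => by positivity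
  have h1 : (T : ℝ) * ∑ q ∈ Q, 1 / (q : ℝ) ^ 2 ≤ T / z := by
    rw [div_eq_mul_one_div]
    gcongr
  have h2 : (∑ q ∈ Q, 1 / (q : ℝ) ^ 2) * ∑ q ∈ Q, 1 / (q : ℝ) ^ 2 ≤ ∑ q ∈ Q, 1 / (q : ℝ) ^ 2 := by
    refine mul_le_of_le_one_left hnn (hsq.trans ?_)
    rw [div_le_one (by linarith)]
    exact hz'
  have h3 : (T : ℝ) * ((∑ q ∈ Q, 1 / (q : ℝ) ^ 2) * ∑ q ∈ Q, 1 / (q : ℝ) ^ 2)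
      ≤ T * ∑ q ∈ Q, 1 / (q : ℝ) ^ 2 := by gcongr
  have h4 : (Q.card : ℝ) * Q.card ≤ (y : ℝ) ^ 2 := by
    rw [sq]
    gcongr
  have h5 : 2 * (T : ℝ) / z = T / z + T / z := by ring
  linarith

/-- Shifted arguments for which a prime sum of deviations exceeds one are rare. -/
lemma card_filter_one_lt_sum_sqrtDev_le {c : ℤ} {z y : ℕ} (hz : 1 ≤ z) {Q : Finset ℕ}
    (hQ : ∀ q ∈ Q, q.Prime ∧ q ≠ 2 ∧ ¬ (q : ℤ) ∣ c ∧ z < q ∧ q ≤ y) (a : ℤ) (T : ℕ) :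
    (((Finset.range T).filter fun i : ℕ =>
      1 < ∑ q ∈ Q, sqrtDev c q ((a + i : ℤ) : ZMod q) / q).card : ℝ) ≤ 2 * T / z + (y : ℝ) ^ 2 := by
  refine le_trans ?_ (sum_sq_sum_sqrtDev_div_le hz hQ a T)
  rw [← nsmul_one]
  refine (Finset.card_nsmul_le_sum _ (fun i : ℕ =>
    (∑ q ∈ Q, sqrtDev c q ((a + i : ℤ) : ZMod q) / q) ^ 2) _ fun i hi => ?_).trans
    (Finset.sum_le_sum_of_subset_of_nonneg (Finset.filter_subset _ _) fun _ _ _ => sq_nonneg _)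
  have := (Finset.mem_filter.1 hi).2
  exact one_le_pow₀ this.le

open ArithmeticFunction in
lemma sum_moebius_filter_dvd {k j w : ℕ} (hk : 0 < k) (hj : Squarefree j) (hjw : j ≤ w) :
    ∑ d ∈ (Finset.Icc 1 w).filter (fun d => k ∣ d ∧ d ∣ j), moebius d
      = if k = j then moebius k else 0 := by
  have hj0 : 0 < j := Nat.pos_of_ne_zero hj.ne_zero
  by_cases hkj : k ∣ j
  · obtain ⟨m, rfl⟩ := hkj
    have hm0 : 0 < m := Nat.pos_of_mul_pos_left hj0
    have hset : (Finset.Icc 1 w).filter (fun d => k ∣ d ∧ d ∣ k * m)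
        = m.divisors.image (fun e => k * e) := by
      ext d
      simp only [Finset.mem_filter, Finset.mem_Icc, Finset.mem_image, Nat.mem_divisors]
      constructor
      · rintro ⟨-, ⟨e, rfl⟩, h⟩
        exact ⟨e, ⟨Nat.dvd_of_mul_dvd_mul_left hk h, hm0.ne'⟩, rfl⟩
      · rintro ⟨e, ⟨he, -⟩, rfl⟩
        have h1 : k * e ∣ k * m := Nat.mul_dvd_mul_left k he
        exact ⟨⟨Nat.mul_pos hk (Nat.pos_of_dvd_of_pos he hm0), (Nat.le_of_dvd hj0 h1).trans hjw⟩,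
          Dvd.intro _ rfl, h1⟩
    rw [hset, Finset.sum_image fun a _ b _ h => Nat.eq_of_mul_eq_mul_left hk h]
    have hmul : ∀ e ∈ m.divisors, moebius (k * e) = moebius k * moebius e := by
      intro e he
      have h1 : k * e ∣ k * m := Nat.mul_dvd_mul_left k (Nat.dvd_of_mem_divisors he)
      have h2 := Nat.squarefree_mul_iff.1 (hj.squarefree_of_dvd h1)
      exact isMultiplicative_moebius.map_mul_of_coprime h2.1
    rw [Finset.sum_congr rfl hmul, ← Finset.mul_sum, ← coe_zeta_mul_apply, coe_zeta_mul_moebius,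
      one_apply]
    by_cases hm : m = 1
    · simp [hm]
    · have : k ≠ k * m := by
        intro h
        exact hm (Nat.eq_of_mul_eq_mul_left hk (by omega))
      simp [hm, this]
  · rw [if_neg (fun h : k = j => hkj h.dvd)]
    refine Finset.sum_eq_zero fun d hd => ?_
    obtain ⟨-, h1, h2⟩ := Finset.mem_filter.1 hd
    exact absurd (h1.trans h2) hkj

/-- The sum of the reciprocals of the squarefree numbers up to `w`. -/
def squarefreeSum (w : ℕ) : ℝ := ∑ k ∈ (Finset.Icc 1 w).filter Squarefree, 1 / (k : ℝ)

lemma log_le_two_mul_squarefreeSum (w : ℕ) : Real.log (w + 1) ≤ 2 * squarefreeSum w := by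
  have h1 : Real.log (w + 1) ≤ ∑ n ∈ Finset.Icc 1 w, 1 / (n : ℝ) := by
    have := log_add_one_le_harmonic w
    rw [harmonic_eq_sum_Icc] at this
    push_cast at this
    simpa only [one_div] using this
  have h2 : ∑ m ∈ Finset.Icc 1 w, 1 / (m : ℝ) ^ 2 ≤ 2 := by
    have hsub : Finset.Icc 1 w ⊆ insert 1 (Finset.Icc 2 w) := by
      intro m hm
      rw [Finset.mem_insert, Finset.mem_Icc]
      rw [Finset.mem_Icc] at hm
      omega
    refine (Finset.sum_le_sum_of_subset_of_nonneg hsub fun _ _ _ => by positivity).trans ?_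
    rw [Finset.sum_insert (by simp)]
    have := sum_one_div_sq_le le_rfl (Finset.Icc 2 w) fun q hq => (Finset.mem_Icc.1 hq).1
    norm_num at this ⊢
    linarith
  choose a b hab hsq using Nat.sq_mul_squarefree
  have h3 : ∑ n ∈ Finset.Icc 1 w, 1 / (n : ℝ)
      ≤ ∑ s ∈ (Finset.Icc 1 w) ×ˢ (Finset.Icc 1 w).filter Squarefree,
        1 / (s.1 : ℝ) ^ 2 * (1 / (s.2 : ℝ)) := by
    have hinj : Set.InjOn (fun n => (b n, a n)) (Finset.Icc 1 w : Set ℕ) := by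
      intro m _ n _ h
      simp only [Prod.mk.injEq] at h
      rw [← hab m, ← hab n, h.1, h.2]
    have himg : (Finset.Icc 1 w).image (fun n => (b n, a n))
        ⊆ (Finset.Icc 1 w) ×ˢ (Finset.Icc 1 w).filter Squarefree := by
      intro s hs
      obtain ⟨n, hn, rfl⟩ := Finset.mem_image.1 hs
      obtain ⟨hn1, hn2⟩ := Finset.mem_Icc.1 hn
      have ha : a n ∣ n := Dvd.intro_left _ (hab n)
      have hb : b n ∣ n := (dvd_pow_self _ two_ne_zero).trans (Dvd.intro _ (hab n))
      have ha0 := Nat.pos_of_dvd_of_pos ha hn1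
      have hb0 := Nat.pos_of_dvd_of_pos hb hn1
      exact Finset.mem_product.2 ⟨Finset.mem_Icc.2 ⟨hb0, (Nat.le_of_dvd hn1 hb).trans hn2⟩,
        Finset.mem_filter.2 ⟨Finset.mem_Icc.2 ⟨ha0, (Nat.le_of_dvd hn1 ha).trans hn2⟩, hsq n⟩⟩
    refine le_trans (le_of_eq ?_) (Finset.sum_le_sum_of_subset_of_nonneg himg
      fun _ _ _ => by positivity)
    rw [Finset.sum_image hinj]
    refine Finset.sum_congr rfl fun n _ => ?_
    rw [div_mul_div_comm, one_mul]
    congr 1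
    exact_mod_cast (hab n).symm
  rw [Finset.sum_product] at h3
  simp only [← Finset.sum_mul_sum] at h3
  refine h1.trans (h3.trans ?_)
  have hnn : 0 ≤ squarefreeSum w := Finset.sum_nonneg fun _ _ => by positivity
  exact mul_le_mul_of_nonneg_right h2 hnn

open ArithmeticFunction in
/-- Selberg's weights for sifting by all primes, with level `w`. -/
def selbergWeight (w d : ℕ) : ℝ :=
  moebius d * (d * ∑ k ∈ (Finset.Icc 1 w).filter (fun k => Squarefree k ∧ d ∣ k),
    1 / (k * squarefreeSum w))

lemma squarefreeSum_pos {w : ℕ} (hw : 1 ≤ w) : 0 < squarefreeSum w :=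
  Finset.sum_pos (fun k hk => by
    have := (Finset.mem_Icc.1 (Finset.mem_filter.1 hk).1).1
    positivity) ⟨1, Finset.mem_filter.2 ⟨Finset.mem_Icc.2 ⟨le_rfl, hw⟩, squarefree_one⟩⟩

lemma selbergWeight_one {w : ℕ} (hw : 1 ≤ w) : selbergWeight w 1 = 1 := by
  have h := (squarefreeSum_pos hw).ne'
  unfold selbergWeight
  simp only [one_dvd, and_true, ArithmeticFunction.moebius_apply_one,
    Nat.cast_one, Int.cast_one, one_mul]
  simp only [← div_div, ← Finset.sum_div]
  exact div_self h

lemma abs_selbergWeight_le_one {w : ℕ} (hw : 1 ≤ w) {d : ℕ} (hd : 0 < d) :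
    |selbergWeight w d| ≤ 1 := by
  have hG := squarefreeSum_pos hw
  have hd' : (0 : ℝ) < d := by exact_mod_cast hd
  unfold selbergWeight
  have hnn : 0 ≤ (d : ℝ) * ∑ k ∈ (Finset.Icc 1 w).filter (fun k => Squarefree k ∧ d ∣ k),
    1 / (k * squarefreeSum w) := mul_nonneg hd'.le (Finset.sum_nonneg fun _ _ => by positivity)
  rw [abs_mul, abs_of_nonneg hnn]
  refine mul_le_one₀ ?_ hnn ?_
  · have := ArithmeticFunction.abs_moebius_le_one (n := d)
    exact_mod_cast this
  · have hle : ∑ k ∈ (Finset.Icc 1 w).filter (fun k => Squarefree k ∧ d ∣ k), (d : ℝ) / k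
        ≤ squarefreeSum w := by
      have hinj : Set.InjOn (fun k => k / d)
          ((Finset.Icc 1 w).filter (fun k => Squarefree k ∧ d ∣ k) : Set ℕ) := by
        intro k hk l hl h
        have hk1 := (Finset.mem_filter.1 (Finset.mem_coe.1 hk)).2.2
        have hl1 := (Finset.mem_filter.1 (Finset.mem_coe.1 hl)).2.2
        rw [← Nat.div_mul_cancel hk1, ← Nat.div_mul_cancel hl1]
        simp only at h
        rw [h]
      have himg : ((Finset.Icc 1 w).filter (fun k => Squarefree k ∧ d ∣ k)).image (fun k => k / d)
          ⊆ (Finset.Icc 1 w).filter Squarefree := by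
        intro m hm
        obtain ⟨k, hk, rfl⟩ := Finset.mem_image.1 hm
        obtain ⟨hk1, hk2, hk3⟩ := Finset.mem_filter.1 hk
        rw [Finset.mem_Icc] at hk1
        refine Finset.mem_filter.2 ⟨Finset.mem_Icc.2 ⟨?_, (Nat.div_le_self _ _).trans hk1.2⟩, ?_⟩
        · exact Nat.div_pos (Nat.le_of_dvd hk1.1 hk3) hd
        · exact hk2.squarefree_of_dvd (Nat.div_dvd_of_dvd hk3)
      refine le_trans (le_of_eq ?_) (Finset.sum_le_sum_of_subset_of_nonneg himg
        fun _ _ _ => by positivity)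
      rw [Finset.sum_image hinj]
      refine Finset.sum_congr rfl fun k hk => ?_
      rw [Nat.cast_div (Finset.mem_filter.1 hk).2.2 hd'.ne']
      simp
    have : (d : ℝ) * ∑ k ∈ (Finset.Icc 1 w).filter (fun k => Squarefree k ∧ d ∣ k),
        1 / (k * squarefreeSum w)
        = (∑ k ∈ (Finset.Icc 1 w).filter (fun k => Squarefree k ∧ d ∣ k), (d : ℝ) / k)
          / squarefreeSum w := by
      rw [Finset.mul_sum, Finset.sum_div]
      refine Finset.sum_congr rfl fun k _ => ?_
      rw [div_div, mul_one_div]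
    rw [this]
    exact div_le_one_of_le₀ hle hG.le

lemma sum_selbergWeight_div {w k : ℕ} (hk : 0 < k) :
    ∑ d ∈ (Finset.Icc 1 w).filter (fun d => k ∣ d), selbergWeight w d / d
      = if k ≤ w then ArithmeticFunction.moebius k / (k * squarefreeSum w) else 0 := by
  have h1 : ∀ d ∈ (Finset.Icc 1 w).filter (fun d => k ∣ d), selbergWeight w d / d
      = ∑ j ∈ (Finset.Icc 1 w).filter Squarefree, if d ∣ j then
        (ArithmeticFunction.moebius d : ℝ) * (1 / (j * squarefreeSum w)) else 0 := by
    intro d hd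
    have hd0 := (Finset.mem_Icc.1 (Finset.mem_filter.1 hd).1).1
    have hd' : (d : ℝ) ≠ 0 := by positivity
    rw [← Finset.sum_filter, Finset.filter_filter, ← Finset.mul_sum]
    unfold selbergWeight
    rw [mul_div_assoc, mul_div_cancel_left₀ _ hd']
  rw [Finset.sum_congr rfl h1, Finset.sum_comm]
  have h2 : ∀ j ∈ (Finset.Icc 1 w).filter Squarefree,
      ∑ d ∈ (Finset.Icc 1 w).filter (fun d => k ∣ d), (if d ∣ j then
        (ArithmeticFunction.moebius d : ℝ) * (1 / (j * squarefreeSum w)) else 0)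
      = if k = j then ArithmeticFunction.moebius k * (1 / (j * squarefreeSum w)) else 0 := by
    intro j hj
    obtain ⟨hj1, hj2⟩ := Finset.mem_filter.1 hj
    have := sum_moebius_filter_dvd hk hj2 (Finset.mem_Icc.1 hj1).2
    rw [← Finset.sum_filter, Finset.filter_filter, ← Finset.sum_mul, ← Int.cast_sum, this]
    split_ifs <;> simp
  rw [Finset.sum_congr rfl h2, Finset.sum_ite_eq]
  by_cases hkw : k ≤ w
  · rw [if_pos hkw]
    by_cases hks : Squarefree k
    · rw [if_pos (Finset.mem_filter.2 ⟨Finset.mem_Icc.2 ⟨hk, hkw⟩, hks⟩)]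
      ring
    · rw [if_neg (fun h => hks (Finset.mem_filter.1 h).2),
        ArithmeticFunction.moebius_eq_zero_of_not_squarefree hks]
      simp
  · rw [if_neg hkw, if_neg (fun h => hkw (Finset.mem_Icc.1 (Finset.mem_filter.1 h).1).2)]

lemma gcd_eq_sum_totient {d e w : ℕ} (hd : 0 < d) (hdw : d ≤ w) :
    Nat.gcd d e = ∑ k ∈ (Finset.Icc 1 w).filter (fun k => k ∣ d ∧ k ∣ e), Nat.totient k := by
  have h0 := Nat.gcd_pos_of_pos_left e hd
  rw [← Nat.sum_totient (Nat.gcd d e)]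
  congr 1
  ext k
  simp only [Nat.mem_divisors, Nat.dvd_gcd_iff, Finset.mem_filter, Finset.mem_Icc]
  constructor
  · rintro ⟨⟨h1, h2⟩, -⟩
    exact ⟨⟨Nat.pos_of_dvd_of_pos h1 hd, (Nat.le_of_dvd hd h1).trans hdw⟩, h1, h2⟩
  · rintro ⟨-, h⟩
    exact ⟨h, h0.ne'⟩

lemma sum_sum_selbergWeight_mul_gcd_le {w : ℕ} (hw : 1 ≤ w) :
    ∑ d ∈ Finset.Icc 1 w, ∑ e ∈ Finset.Icc 1 w,
      selbergWeight w d / d * (selbergWeight w e / e) * (Nat.gcd d e : ℝ)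
      ≤ 1 / squarefreeSum w := by
  have hG := squarefreeSum_pos hw
  have h1 : ∑ d ∈ Finset.Icc 1 w, ∑ e ∈ Finset.Icc 1 w,
      selbergWeight w d / d * (selbergWeight w e / e) * (Nat.gcd d e : ℝ)
      = ∑ k ∈ Finset.Icc 1 w, (Nat.totient k : ℝ) *
        (∑ d ∈ (Finset.Icc 1 w).filter (fun d => k ∣ d), selbergWeight w d / d) ^ 2 := by
    have h2 : ∀ d ∈ Finset.Icc 1 w, ∀ e ∈ Finset.Icc 1 w,
        selbergWeight w d / d * (selbergWeight w e / e) * (Nat.gcd d e : ℝ)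
        = ∑ k ∈ Finset.Icc 1 w, (Nat.totient k : ℝ) *
          ((if k ∣ d then selbergWeight w d / d else 0) *
            (if k ∣ e then selbergWeight w e / e else 0)) := by
      intro d hd e he
      obtain ⟨hd1, hd2⟩ := Finset.mem_Icc.1 hd
      rw [gcd_eq_sum_totient hd1 hd2, Finset.sum_filter, Nat.cast_sum, Finset.mul_sum]
      refine Finset.sum_congr rfl fun k _ => ?_
      by_cases hkd : k ∣ d <;> by_cases hke : k ∣ e <;> simp [hkd, hke, mul_comm]
    rw [Finset.sum_congr rfl fun d hd => Finset.sum_congr rfl fun e he => h2 d hd e he]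
    rw [Finset.sum_congr rfl fun d _ => Finset.sum_comm, Finset.sum_comm]
    refine Finset.sum_congr rfl fun k _ => ?_
    rw [sq, Finset.sum_filter, Finset.sum_mul_sum, Finset.mul_sum]
    exact Finset.sum_congr rfl fun d _ => by rw [Finset.mul_sum]
  rw [h1]
  have h3 : ∀ k ∈ Finset.Icc 1 w, (Nat.totient k : ℝ) *
        (∑ d ∈ (Finset.Icc 1 w).filter (fun d => k ∣ d), selbergWeight w d / d) ^ 2
      ≤ if Squarefree k then 1 / (k : ℝ) * (1 / squarefreeSum w ^ 2) else 0 := by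
    intro k hk
    obtain ⟨hk1, hk2⟩ := Finset.mem_Icc.1 hk
    have hk0 : (0 : ℝ) < k := by exact_mod_cast hk1
    rw [sum_selbergWeight_div hk1, if_pos hk2]
    split_ifs with hks
    · have hm : ((ArithmeticFunction.moebius k : ℤ) : ℝ) ^ 2 = 1 := by
        exact_mod_cast ArithmeticFunction.moebius_sq_eq_one_of_squarefree hks
      have ht : (Nat.totient k : ℝ) ≤ k := by exact_mod_cast Nat.totient_le k
      rw [div_pow, hm]
      calc (Nat.totient k : ℝ) * (1 / (k * squarefreeSum w) ^ 2)
          ≤ k * (1 / (k * squarefreeSum w) ^ 2) := by gcongr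
        _ = _ := by field_simp
    · rw [ArithmeticFunction.moebius_eq_zero_of_not_squarefree hks]
      simp
  refine (Finset.sum_le_sum h3).trans (le_of_eq ?_)
  rw [← Finset.sum_filter, ← Finset.sum_mul]
  change squarefreeSum w * _ = _
  field_simp

lemma abs_card_filter_dvd_Ioc_sub_le (b T : ℕ) {m : ℕ} (hm : 0 < m) :
    |(((Finset.Ioc b (b + T)).filter (fun n => m ∣ n)).card : ℝ) - T / m| ≤ 1 := by
  have hm' : (0 : ℝ) < m := by exact_mod_cast hm
  have h0 : ((Finset.Ioc 0 (b + T)).filter (fun n => m ∣ n)).card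
      = ((Finset.Ioc 0 b).filter (fun n => m ∣ n)).card
        + ((Finset.Ioc b (b + T)).filter (fun n => m ∣ n)).card := by
    rw [← Finset.Ioc_union_Ioc_eq_Ioc (Nat.zero_le b) (Nat.le_add_right b T), Finset.filter_union,
      Finset.card_union_of_disjoint]
    refine Finset.disjoint_filter_filter (Finset.disjoint_left.2 fun n h1 h2 => ?_)
    rw [Finset.mem_Ioc] at h1 h2
    omega
  rw [Nat.Ioc_filter_dvd_card_eq_div, Nat.Ioc_filter_dvd_card_eq_div] at h0
  set c := ((Finset.Ioc b (b + T)).filter (fun n => m ∣ n)).card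
  have h1 := Nat.div_add_mod (b + T) m
  have h2 := Nat.div_add_mod b m
  have h3 := Nat.mod_lt (b + T) hm
  have h4 := Nat.mod_lt b hm
  rw [h0] at h1
  have h5 : m * c + (b + T) % m = T + b % m := by
    rw [mul_add] at h1
    omega
  have h6 : (m : ℝ) * c + ((b + T) % m : ℕ) = T + (b % m : ℕ) := by exact_mod_cast h5
  have h7 : (((b + T) % m : ℕ) : ℝ) ≤ m := by exact_mod_cast h3.le
  have h8 : ((b % m : ℕ) : ℝ) ≤ m := by exact_mod_cast h4.le
  have h9 : (0 : ℝ) ≤ ((b + T) % m : ℕ) := Nat.cast_nonneg _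
  have h10 : (0 : ℝ) ≤ (b % m : ℕ) := Nat.cast_nonneg _
  have h11 : (c : ℝ) - T / m = (m * c - T) / m := by field_simp
  rw [h11, abs_div, abs_of_pos hm', div_le_one hm', abs_le]
  constructor <;> linarith

lemma one_le_sq_sum_selbergWeight {w p : ℕ} (hw : 1 ≤ w) (hp : p.Prime) (hwp : w < p) :
    (∑ d ∈ Finset.Icc 1 w, if d ∣ p then selbergWeight w d else 0) ^ 2 = 1 := by
  rw [Finset.sum_eq_single 1]
  · simp [selbergWeight_one hw]
  · intro d hd hd1
    rw [if_neg]
    intro h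
    rcases (Nat.dvd_prime hp).1 h with h | h
    · exact hd1 h
    · have := (Finset.mem_Icc.1 hd).2
      omega
  · intro h
    exact absurd (Finset.mem_Icc.2 ⟨le_rfl, hw⟩) h

/-- Selberg's upper bound for the number of primes in a short interval. -/
lemma card_filter_prime_Ioc_le {w : ℕ} (hw : 1 ≤ w) (b T : ℕ) :
    (((Finset.Ioc b (b + T)).filter Nat.Prime).card : ℝ)
      ≤ T / squarefreeSum w + (w : ℝ) ^ 2 + w := by
  have hG := squarefreeSum_pos hw
  set S := Finset.Ioc b (b + T)
  have h1 : (((S.filter Nat.Prime).filter (fun n => w < n)).card : ℝ)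
      ≤ ∑ n ∈ S, (∑ d ∈ Finset.Icc 1 w, if d ∣ n then selbergWeight w d else 0) ^ 2 := by
    rw [← nsmul_one]
    refine (Finset.card_nsmul_le_sum _ (fun n : ℕ =>
      (∑ d ∈ Finset.Icc 1 w, if d ∣ n then selbergWeight w d else 0) ^ 2) _ fun n hn => ?_).trans
      (Finset.sum_le_sum_of_subset_of_nonneg
        ((Finset.filter_subset _ _).trans (Finset.filter_subset _ _)) fun _ _ _ => sq_nonneg _)
    obtain ⟨hn1, hn2⟩ := Finset.mem_filter.1 hn
    exact (one_le_sq_sum_selbergWeight hw (Finset.mem_filter.1 hn1).2 hn2).ge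
  have h2 : (((S.filter Nat.Prime).filter (fun n => ¬ w < n)).card : ℝ) ≤ w := by
    have hsub : (S.filter Nat.Prime).filter (fun n => ¬ w < n) ⊆ Finset.Ioc 0 w := by
      intro n hn
      obtain ⟨hn1, hn2⟩ := Finset.mem_filter.1 hn
      exact Finset.mem_Ioc.2 ⟨(Finset.mem_filter.1 hn1).2.pos, not_lt.1 hn2⟩
    have := Finset.card_le_card hsub
    rw [Nat.card_Ioc] at this
    exact_mod_cast this
  have h3 : ∑ n ∈ S, (∑ d ∈ Finset.Icc 1 w, if d ∣ n then selbergWeight w d else 0) ^ 2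
      = ∑ d ∈ Finset.Icc 1 w, ∑ e ∈ Finset.Icc 1 w, selbergWeight w d * selbergWeight w e *
        ((S.filter (fun n => Nat.lcm d e ∣ n)).card : ℝ) := by
    have h4 : ∀ n ∈ S, (∑ d ∈ Finset.Icc 1 w, if d ∣ n then selbergWeight w d else 0) ^ 2
        = ∑ d ∈ Finset.Icc 1 w, ∑ e ∈ Finset.Icc 1 w,
          selbergWeight w d * selbergWeight w e * (if Nat.lcm d e ∣ n then 1 else 0) := by
      intro n _
      rw [sq, Finset.sum_mul_sum]
      refine Finset.sum_congr rfl fun d _ => Finset.sum_congr rfl fun e _ => ?_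
      simp only [Nat.lcm_dvd_iff]
      by_cases hd : d ∣ n <;> by_cases he : e ∣ n <;> simp [hd, he]
    rw [Finset.sum_congr rfl h4, Finset.sum_comm]
    refine Finset.sum_congr rfl fun d _ => ?_
    rw [Finset.sum_comm]
    refine Finset.sum_congr rfl fun e _ => ?_
    rw [← Finset.mul_sum, Finset.sum_boole]
  have h5 : ∀ d ∈ Finset.Icc 1 w, ∀ e ∈ Finset.Icc 1 w, selbergWeight w d * selbergWeight w e *
        ((S.filter (fun n => Nat.lcm d e ∣ n)).card : ℝ)
      ≤ T * (selbergWeight w d / d * (selbergWeight w e / e) * (Nat.gcd d e : ℝ)) + 1 := by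
    intro d hd e he
    have hd0 := (Finset.mem_Icc.1 hd).1
    have he0 := (Finset.mem_Icc.1 he).1
    have hl : 0 < Nat.lcm d e := Nat.lcm_pos hd0 he0
    have h6 := abs_card_filter_dvd_Ioc_sub_le b T hl
    have h7 : (Nat.gcd d e : ℝ) * Nat.lcm d e = d * e := by exact_mod_cast Nat.gcd_mul_lcm d e
    have h8 : (T : ℝ) / Nat.lcm d e = T * (1 / d * (1 / e) * Nat.gcd d e) := by
      have hd1 : (0 : ℝ) < d := by exact_mod_cast hd0
      have he1 : (0 : ℝ) < e := by exact_mod_cast he0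
      have hl1 : (0 : ℝ) < Nat.lcm d e := by exact_mod_cast hl
      field_simp
      linear_combination (T : ℝ) * (-h7)
    set c : ℝ := ((S.filter (fun n => Nat.lcm d e ∣ n)).card : ℝ)
    have h9 : selbergWeight w d * selbergWeight w e * (c - T / Nat.lcm d e) ≤ 1 := by
      refine (le_abs_self _).trans ?_
      rw [abs_mul, abs_mul]
      exact mul_le_one₀ (mul_le_one₀ (abs_selbergWeight_le_one hw hd0) (abs_nonneg _)
        (abs_selbergWeight_le_one hw he0)) (abs_nonneg _) h6
    rw [mul_sub, h8] at h9
    have h10 : selbergWeight w d * selbergWeight w e * (T * (1 / d * (1 / e) * Nat.gcd d e))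
        = T * (selbergWeight w d / d * (selbergWeight w e / e) * (Nat.gcd d e : ℝ)) := by ring
    linarith
  have h6 : ∑ n ∈ S, (∑ d ∈ Finset.Icc 1 w, if d ∣ n then selbergWeight w d else 0) ^ 2
      ≤ T / squarefreeSum w + (w : ℝ) ^ 2 := by
    rw [h3]
    refine (Finset.sum_le_sum fun d hd => Finset.sum_le_sum fun e he => h5 d hd e he).trans ?_
    simp only [Finset.sum_add_distrib, ← Finset.mul_sum, Finset.sum_const, nsmul_eq_mul, mul_one,
      Nat.card_Icc, add_tsub_cancel_right]
    have h7 := mul_le_mul_of_nonneg_left (sum_sum_selbergWeight_mul_gcd_le hw)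
      (Nat.cast_nonneg (α := ℝ) T)
    rw [mul_one_div] at h7
    rw [sq]
    linarith
  rw [← Finset.card_filter_add_card_filter_not (s := S.filter Nat.Prime) (fun n => w < n)]
  push_cast
  linarith

lemma exists_HKr_mul_log_le : ∃ C : ℝ, 0 < C ∧ ∀ (M : ℕ) (D : ℤ), 1 ≤ M → -D ≤ M →
    HKr D * Real.log M.sqrt ≤
      C * M.sqrt * Real.exp (∑ q ∈ M.sqrt.primesLE, primeWeight D q / q) := by
  obtain ⟨C, hC, h⟩ := exists_sum_sqrtCount_mul_log_le
  set B : ℝ := ∑' n : ℕ, (1 / √(n : ℝ)) ^ 3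
  refine ⟨3 * C * Real.exp (16 * B), by positivity, fun M D hM hD => ?_⟩
  have hs : 1 ≤ M.sqrt := Nat.le_sqrt.2 (by omega)
  have hlog : 0 ≤ Real.log M.sqrt := Real.log_natCast_nonneg _
  have h1 := mul_le_mul_of_nonneg_right (HKr_le_sum_sqrtCount hD) hlog
  have h2 := h D M.sqrt hs
  have h3 := sum_sqrtCount_div_le_exp D M.sqrt
  rw [Finset.sum_add_distrib, ← Finset.mul_sum] at h3
  have h4 : ∑ q ∈ M.sqrt.primesLE, (1 / √(q : ℝ)) ^ 3 ≤ B :=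
    summable_one_div_sqrt_pow_three.sum_le_tsum _ fun _ _ => by positivity
  have h5 : ∑ a ∈ Finset.Icc 1 M.sqrt, (sqrtCount D a : ℝ) / a ≤
      Real.exp (∑ q ∈ M.sqrt.primesLE, primeWeight D q / q) * Real.exp (16 * B) := by
    rw [← Real.exp_add]
    refine h3.trans (Real.exp_le_exp.2 ?_)
    linarith
  have h6 := mul_le_mul_of_nonneg_left h5 (by positivity : 0 ≤ C * (M.sqrt : ℝ))
  nlinarith

lemma sum_one_div_prime_dvd_le {z y M : ℕ} (hz : 1 ≤ z) {n : ℤ} (hn : n ≠ 0)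
    (hM : n.natAbs ≤ M) :
    ∑ q ∈ y.primesLE.filter (fun q => z < q ∧ (q : ℤ) ∣ n), 1 / (q : ℝ)
      ≤ Real.log M / (Real.log 2 * z) := by
  have hz' : (0 : ℝ) < z := by exact_mod_cast hz
  have hn0 : n.natAbs ≠ 0 := Int.natAbs_ne_zero.2 hn
  set P := n.natAbs.primeFactors
  have h1 : (2 : ℝ) ^ P.card ≤ M := by
    have h2 : 2 ^ P.card ≤ ∏ q ∈ P, q :=
      Finset.pow_card_le_prod _ _ _ fun q hq => (Nat.prime_of_mem_primeFactors hq).two_le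
    have h3 : ∏ q ∈ P, q ≤ n.natAbs := Nat.le_of_dvd (Nat.pos_of_ne_zero hn0)
      (Nat.prod_primeFactors_dvd _)
    exact_mod_cast h2.trans (h3.trans hM)
  have h4 : P.card * Real.log 2 ≤ Real.log M := by
    rw [← Real.log_pow]
    exact Real.log_le_log (by positivity) h1
  have hl : 0 < Real.log 2 := by positivity
  have hsub : y.primesLE.filter (fun q => z < q ∧ (q : ℤ) ∣ n) ⊆ P := by
    intro q hq
    obtain ⟨hq1, -, hq2⟩ := Finset.mem_filter.1 hq
    exact Nat.mem_primeFactors.2 ⟨Nat.prime_of_mem_primesLE hq1, Int.natCast_dvd.1 hq2, hn0⟩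
  calc ∑ q ∈ y.primesLE.filter (fun q => z < q ∧ (q : ℤ) ∣ n), 1 / (q : ℝ)
      ≤ ∑ q ∈ y.primesLE.filter (fun q => z < q ∧ (q : ℤ) ∣ n), 1 / (z : ℝ) := by
        refine Finset.sum_le_sum fun q hq => ?_
        have : (z : ℝ) < q := by exact_mod_cast (Finset.mem_filter.1 hq).2.1
        gcongr
    _ ≤ ∑ q ∈ P, 1 / (z : ℝ) := Finset.sum_le_sum_of_subset_of_nonneg hsub
        fun _ _ _ => by positivity
    _ = P.card * (1 / (z : ℝ)) := by rw [Finset.sum_const, nsmul_eq_mul]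
    _ ≤ (Real.log M / Real.log 2) * (1 / (z : ℝ)) := by
        gcongr
        rwa [le_div_iff₀ hl]
    _ = _ := by rw [div_mul_div_comm, mul_one]

lemma sum_primeWeight_div_le {c t : ℤ} {z y s : ℕ} :
    ∑ q ∈ s.primesLE, primeWeight (t ^ 2 - c) q / q ≤
      ∑ q ∈ z.primesLE, 1 / (q : ℝ) + ∑ q ∈ y.primesLE, 1 / (q : ℝ)
      + ∑ q ∈ y.primesLE.filter (fun q => z < q ∧ ¬ (q : ℤ) ∣ c), sqrtDev c q (t : ZMod q) / q
      + ∑ q ∈ y.primesLE.filter (fun q => z < q ∧ (q : ℤ) ∣ c), 1 / (q : ℝ)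
      + ∑ q ∈ y.primesLE.filter (fun q => z < q ∧ (q : ℤ) ∣ t ^ 2 - c), 1 / (q : ℝ)
      + 2 * ∑ q ∈ s.primesLE.filter (fun q => y < q), 1 / (q : ℝ) := by
  set D := t ^ 2 - c
  set U := s ⊔ (z ⊔ y)
  have hex : ∀ n ≤ U, ∀ f : ℕ → ℝ, ∀ (P : ℕ → Prop) [DecidablePred P],
      ∑ q ∈ n.primesLE.filter P, f q = ∑ q ∈ U.primesLE, if q ≤ n ∧ P q then f q else 0 := by
    intro n hn f P _
    rw [← Finset.sum_filter]
    congr 1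
    ext q
    simp only [Finset.mem_filter, Nat.mem_primesLE]
    constructor
    · rintro ⟨⟨h1, h2⟩, h3⟩
      exact ⟨⟨h1.trans hn, h2⟩, h1, h3⟩
    · rintro ⟨⟨-, h2⟩, h1, h3⟩
      exact ⟨⟨h1, h2⟩, h3⟩
  have hex' : ∀ n ≤ U, ∀ f : ℕ → ℝ,
      ∑ q ∈ n.primesLE, f q = ∑ q ∈ U.primesLE, if q ≤ n then f q else 0 := by
    intro n hn f
    have := hex n hn f (fun _ => True)
    simpa using this
  have hsU : s ≤ U := le_sup_left
  have hzU : z ≤ U := le_sup_left.trans le_sup_right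
  have hyU : y ≤ U := le_sup_right.trans le_sup_right
  rw [hex' s hsU, hex' z hzU, hex' y hyU, hex y hyU, hex y hyU, hex y hyU, hex s hsU,
    Finset.mul_sum, ← Finset.sum_add_distrib, ← Finset.sum_add_distrib, ← Finset.sum_add_distrib,
    ← Finset.sum_add_distrib, ← Finset.sum_add_distrib]
  refine Finset.sum_le_sum fun q hq => ?_
  have hqp := Nat.prime_of_mem_primesLE hq
  have hq0 : (0 : ℝ) < q := by exact_mod_cast hqp.pos
  have hw0 : 0 ≤ primeWeight D q / q := div_nonneg (primeWeight_nonneg D q) hq0.le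
  have hw2 : primeWeight D q / q ≤ 2 * (1 / q) := by
    rw [mul_one_div]
    exact div_le_div_of_nonneg_right (primeWeight_le_two D hqp) hq0.le
  have hr0 : (0 : ℝ) < 1 / q := by positivity
  have hdev : sqrtDev c q (t : ZMod q) / q = sqrtCount D q / q - 1 / q := by
    rw [sqrtDev_intCast, sub_div]
  have hdec : primeWeight D q / q = sqrtCount D q / q + if (q : ℤ) ∣ D then 1 / (q : ℝ) else 0 := by
    unfold primeWeight
    rw [add_div]
    split_ifs <;> simp
  have hcnt : (sqrtCount D q : ℝ) / q ≤ 2 * (1 / q) := by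
    rw [mul_one_div]
    refine div_le_div_of_nonneg_right ?_ hq0.le
    exact_mod_cast sqrtCount_prime_le_two D hqp
  have hcnt0 : (0 : ℝ) ≤ (sqrtCount D q : ℝ) / q := by positivity
  by_cases h1 : q ≤ z
  · have h1' : ¬ z < q := by omega
    simp only [h1, h1', if_true, false_and, and_false, if_false]
    split_ifs <;> first | omega | linarith
  · have h1' : z < q := by omega
    by_cases h2 : q ≤ y
    · have h2' : ¬ y < q := by omega
      simp only [h1, h1', h2, h2', if_true, true_and, and_false, if_false]
      rw [hdev]
      by_cases h3 : (q : ℤ) ∣ c <;> by_cases h4 : (q : ℤ) ∣ D <;>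
        simp only [h3, h4, if_true, if_false, not_true, not_false_iff] at hdec ⊢ <;>
        split_ifs <;> linarith
    · have h2' : y < q := by omega
      simp only [h1, h2, h2', false_and, if_false, and_true]
      split_ifs <;> linarith

lemma exists_HKr_le_mul_log : ∃ C : ℝ, 0 < C ∧ ∀ (M : ℕ) (D : ℤ), 2 ≤ M.sqrt → -D ≤ M →
    HKr D ≤ C * M.sqrt * Real.log M.sqrt := by
  obtain ⟨C₁, hC₁, h₁⟩ := exists_HKr_mul_log_le
  obtain ⟨C₂, hC₂, h₂⟩ := exists_sum_inv_prime_le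
  refine ⟨C₁ * Real.exp (2 * C₂), by positivity, fun M D hM hD => ?_⟩
  have hM1 : 1 ≤ M := by
    by_contra h
    have : M = 0 := by omega
    simp [this] at hM
  have hlog : 0 < Real.log M.sqrt := Real.log_pos (by exact_mod_cast hM)
  have hW : ∑ q ∈ M.sqrt.primesLE, primeWeight D q / q ≤
      Real.log (Real.log M.sqrt) + Real.log (Real.log M.sqrt) + 2 * C₂ := by
    have h3 := h₂ _ hM
    have h4 : ∑ q ∈ M.sqrt.primesLE, primeWeight D q / q
        ≤ 2 * ∑ q ∈ M.sqrt.primesLE, (1 : ℝ) / q := by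
      rw [Finset.mul_sum]
      refine Finset.sum_le_sum fun q hq => ?_
      rw [mul_one_div]
      exact div_le_div_of_nonneg_right (primeWeight_le_two D (Nat.prime_of_mem_primesLE hq))
        (Nat.cast_nonneg q)
    linarith
  have h5 := Real.exp_le_exp.2 hW
  rw [Real.exp_add, Real.exp_add, Real.exp_log hlog] at h5
  have h6 := (h₁ M D hM1 hD).trans
    (mul_le_mul_of_nonneg_left h5 (by positivity : 0 ≤ C₁ * (M.sqrt : ℝ)))
  refine le_of_mul_le_mul_right (h6.trans (le_of_eq ?_)) hlog
  ring

lemma exists_HKr_mul_log_le_of_sum_sqrtDev_le (K : ℝ) : ∃ C : ℝ, 0 < C ∧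
    ∀ (M z y : ℕ) (t : ℤ), 2 ≤ z → 2 ≤ y → 1 ≤ M → t ^ 2 < M →
    Real.log M ≤ Real.log 2 * z → Real.log M.sqrt + Real.log 4 ≤ K * Real.log y →
    ∑ q ∈ y.primesLE.filter (fun q => z < q ∧ ¬ (q : ℤ) ∣ M),
      sqrtDev M q (t : ZMod q) / q ≤ 1 →
    HKr (t ^ 2 - M) * Real.log M.sqrt ≤ C * M.sqrt * Real.log z * Real.log y := by
  obtain ⟨C₁, hC₁, h₁⟩ := exists_HKr_mul_log_le
  obtain ⟨C₂, hC₂, h₂⟩ := exists_sum_inv_prime_le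
  refine ⟨C₁ * Real.exp (2 * C₂ + 3 + 2 * K), by positivity, ?_⟩
  intro M z y t hz hy hM ht hMz hMy hdev
  have hlz : 0 < Real.log z := Real.log_pos (by exact_mod_cast hz)
  have hly : 0 < Real.log y := Real.log_pos (by exact_mod_cast hy)
  have hl2 : 0 < Real.log 2 := by positivity
  have hz0 : (0 : ℝ) < z := by positivity
  have hM0 : (0 : ℤ) < M := by exact_mod_cast hM
  have hs : 1 ≤ M.sqrt := Nat.le_sqrt.2 (by omega)
  have hq : Real.log M / (Real.log 2 * z) ≤ 1 := by
    rw [div_le_one (by positivity)]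
    exact hMz
  have ht0 := sq_nonneg t
  have e1 := h₂ z hz
  have e2 := h₂ y hy
  have e3 : ∑ q ∈ y.primesLE.filter (fun q => z < q ∧ (q : ℤ) ∣ (M : ℤ)), 1 / (q : ℝ) ≤ 1 :=
    (sum_one_div_prime_dvd_le (by omega) hM0.ne' (by simp)).trans hq
  have e4 : ∑ q ∈ y.primesLE.filter (fun q => z < q ∧ (q : ℤ) ∣ t ^ 2 - M), 1 / (q : ℝ) ≤ 1 :=
    (sum_one_div_prime_dvd_le (by omega) (by omega) (by omega)).trans hq
  have e5 : ∑ q ∈ M.sqrt.primesLE.filter (fun q => y < q), 1 / (q : ℝ) ≤ K := by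
    refine (sum_inv_prime_Ioc_le hy hs).trans ?_
    rwa [div_le_iff₀ hly]
  have hW := sum_primeWeight_div_le (c := M) (t := t) (z := z) (y := y) (s := M.sqrt)
  have hW2 : ∑ q ∈ M.sqrt.primesLE, primeWeight (t ^ 2 - M) q / q ≤
      Real.log (Real.log z) + Real.log (Real.log y) + (2 * C₂ + 3 + 2 * K) := by
    linarith
  have h5 := Real.exp_le_exp.2 hW2
  rw [Real.exp_add, Real.exp_add, Real.exp_log hlz, Real.exp_log hly] at h5
  have h6 := (h₁ M (t ^ 2 - M) hM (by omega)).trans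
    (mul_le_mul_of_nonneg_left h5 (by positivity : 0 ≤ C₁ * (M.sqrt : ℝ)))
  refine h6.trans (le_of_eq ?_)
  ring

lemma mem_primesInHasse_bounds {N p : ℕ} (hp : p ∈ primesInHasse N) :
    p.Prime ∧ ((p : ℤ) - N - 1) ^ 2 < 4 * N := by
  obtain ⟨-, h1, h2, h3⟩ := Finset.mem_filter.1 hp
  refine ⟨h1, ?_⟩
  have hs : √(N : ℝ) ^ 2 = N := Real.sq_sqrt (Nat.cast_nonneg N)
  have hs0 := Real.sqrt_nonneg (N : ℝ)
  have h4 : ((p : ℝ) - N - 1) ^ 2 < (2 * √(N : ℝ)) ^ 2 := by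
    apply sq_lt_sq'
    · nlinarith
    · nlinarith
  rw [mul_pow, hs] at h4
  norm_num at h4
  exact_mod_cast h4

lemma DN_eq (N p : ℕ) : DN N p = ((p : ℤ) - N - 1) ^ 2 - (4 * N : ℕ) := by
  unfold DN
  push_cast
  ring

lemma primesInHasse_subset_Ioc {N : ℕ} (hN : 4 ≤ N) :
    primesInHasse N ⊆
      (Finset.Ioc (N - (4 * N).sqrt) (N - (4 * N).sqrt + (2 * (4 * N).sqrt + 1))).filter Nat.Prime := by
  intro p hp
  obtain ⟨h1, h2⟩ := mem_primesInHasse_bounds hp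
  have hsN : (4 * N).sqrt ≤ N := by
    rw [← Nat.lt_succ_iff, Nat.sqrt_lt]
    nlinarith
  have h3 : ((p : ℤ) - N - 1).natAbs ≤ (4 * N).sqrt := by
    rw [Nat.le_sqrt']
    zify
    rw [sq_abs]
    exact h2.le
  refine Finset.mem_filter.2 ⟨Finset.mem_Ioc.2 ⟨?_, ?_⟩, h1⟩ <;> omega

lemma eventually_log_sq_le_rpow : ∀ᶠ N : ℕ in Filter.atTop,
    16 ≤ Real.log N ∧ Real.log N ^ 2 + 2 ≤ (N : ℝ) ^ (1 / 8 : ℝ) := by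
  have h1 : Filter.Tendsto (fun N : ℕ => Real.log N) Filter.atTop Filter.atTop :=
    Real.tendsto_log_atTop.comp tendsto_natCast_atTop_atTop
  have h2 : ∀ᶠ x : ℝ in Filter.atTop, Real.log x ^ 2 ≤ 1 / 2 * x ^ (1 / 8 : ℝ) := by
    have h3 := (Real.isLittleO_pow_log_id_atTop (n := 2)).comp_tendsto
      (tendsto_rpow_atTop (by norm_num : (0 : ℝ) < 1 / 8))
    have h4 := h3.bound (by norm_num : (0 : ℝ) < 1 / 128)
    filter_upwards [h4, Filter.eventually_gt_atTop 0] with x hx hx0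
    simp only [Function.comp_apply, id_eq, Real.log_rpow hx0] at hx
    rw [Real.norm_of_nonneg (by positivity), Real.norm_of_nonneg (by positivity)] at hx
    nlinarith
  filter_upwards [h1.eventually_ge_atTop 16, tendsto_natCast_atTop_atTop.eventually h2] with N hN hx
  exact ⟨hN, by nlinarith⟩

lemma sqrt_four_mul_bounds {N : ℕ} (hN : 1 ≤ N) :
    √(N : ℝ) ≤ ((4 * N).sqrt : ℝ) ∧ ((4 * N).sqrt : ℝ) ≤ 2 * √(N : ℝ) := by
  have hs : √(N : ℝ) ^ 2 = N := Real.sq_sqrt (Nat.cast_nonneg N)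
  have h1 : 1 ≤ √(N : ℝ) := Real.one_le_sqrt.2 (by exact_mod_cast hN)
  have h2 : ((4 * N).sqrt : ℝ) ^ 2 ≤ 4 * N := by exact_mod_cast Nat.sqrt_le' (4 * N)
  have h3 : (4 * N : ℝ) < (((4 * N).sqrt : ℝ) + 1) ^ 2 := by
    exact_mod_cast Nat.lt_succ_sqrt' (4 * N)
  have h0 : (0 : ℝ) ≤ ((4 * N).sqrt : ℝ) := Nat.cast_nonneg _
  constructor <;> nlinarith

lemma log_natCeil_sq_le {l : ℝ} (hl : 2 ≤ l) : Real.log ⌈l ^ 2⌉₊ ≤ 3 * Real.log l := by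
  have h1 : (⌈l ^ 2⌉₊ : ℝ) < l ^ 2 + 1 := Nat.ceil_lt_add_one (by positivity)
  have h2 : (0 : ℝ) < ⌈l ^ 2⌉₊ := by
    exact_mod_cast Nat.ceil_pos.2 (by positivity)
  have h3 : (⌈l ^ 2⌉₊ : ℝ) ≤ l ^ 3 := by nlinarith [sq_nonneg l]
  have h4 := Real.log_le_log h2 h3
  rw [Real.log_pow] at h4
  exact_mod_cast h4

lemma log_natFloor_rpow_bounds {N : ℕ} (hl : 16 ≤ Real.log N)
    (hu : 2 ≤ (N : ℝ) ^ (1 / 8 : ℝ)) :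
    Real.log N / 16 ≤ Real.log ⌊(N : ℝ) ^ (1 / 8 : ℝ)⌋₊ ∧
      Real.log ⌊(N : ℝ) ^ (1 / 8 : ℝ)⌋₊ ≤ Real.log N := by
  set u := (N : ℝ) ^ (1 / 8 : ℝ) with hu_def
  have hN0 : (0 : ℝ) < N := by
    rcases Nat.eq_zero_or_pos N with h | h
    · norm_num [h] at hl
    · exact_mod_cast h
  have hlog : Real.log u = Real.log N / 8 := by
    rw [hu_def, Real.log_rpow hN0]
    ring
  have h1 : (⌊u⌋₊ : ℝ) ≤ u := Nat.floor_le (by linarith)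
  have h2 : u < ⌊u⌋₊ + 1 := Nat.lt_floor_add_one u
  constructor
  · have h3 : u / 2 ≤ ⌊u⌋₊ := by linarith
    have h4 := Real.log_le_log (by linarith) h3
    rw [Real.log_div (by linarith) (by norm_num), hlog] at h4
    linarith [Real.log_two_lt_d9]
  · have h4 := Real.log_le_log (by linarith) h1
    linarith

lemma card_exceptional_le {N z y : ℕ} (hz : 2 ≤ z) :
    (((primesInHasse N).filter fun p : ℕ =>
        1 < ∑ q ∈ y.primesLE.filter (fun q => z < q ∧ ¬ (q : ℤ) ∣ (4 * N : ℕ)),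
          sqrtDev (4 * N : ℕ) q (((p : ℤ) - N - 1 : ℤ) : ZMod q) / q).card : ℝ)
      ≤ 2 * ((2 * (4 * N).sqrt + 1 : ℕ) : ℝ) / z + (y : ℝ) ^ 2 := by
  set s := (4 * N).sqrt with hs
  have h := card_filter_one_lt_sum_sqrtDev_le (c := (4 * N : ℕ)) (z := z) (y := y) (by omega)
    (Q := y.primesLE.filter (fun q => z < q ∧ ¬ (q : ℤ) ∣ (4 * N : ℕ)))
    (fun q hq => by
      obtain ⟨h1, h2, h3⟩ := Finset.mem_filter.1 hq
      exact ⟨Nat.prime_of_mem_primesLE h1, by omega, h3, h2, Nat.le_of_mem_primesLE h1⟩)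
    (-(s : ℤ)) (2 * s + 1)
  refine le_trans ?_ h
  have hb : ∀ p ∈ primesInHasse N, ((p : ℤ) - N - 1).natAbs ≤ s := by
    intro p hp
    rw [hs, Nat.le_sqrt']
    zify
    rw [sq_abs]
    exact (mem_primesInHasse_bounds hp).2.le
  refine Nat.cast_le.2 (Finset.card_le_card_of_injOn (fun p => p + s - N - 1) ?_ ?_)
  · intro p hp
    obtain ⟨h1, h2⟩ := Finset.mem_filter.1 (Finset.mem_coe.1 hp)
    have h3 := hb p h1
    refine Finset.mem_coe.2 (Finset.mem_filter.2 ⟨Finset.mem_range.2 (by dsimp only; omega), ?_⟩)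
    have h4 : -(s : ℤ) + ((p + s - N - 1 : ℕ) : ℤ) = (p : ℤ) - N - 1 := by omega
    simp only [h4]
    exact h2
  · intro p hp q hq hpq
    have h3 := hb p (Finset.mem_filter.1 (Finset.mem_coe.1 hp)).1
    have h4 := hb q (Finset.mem_filter.1 (Finset.mem_coe.1 hq)).1
    simp only at hpq
    omega

lemma card_primesInHasse_le {N y : ℕ} (hN : 4 ≤ N) (hy : 2 ≤ y) :
    ((primesInHasse N).card : ℝ)
      ≤ 2 * ((2 * (4 * N).sqrt + 1 : ℕ) : ℝ) / Real.log y + (y : ℝ) ^ 2 + y := by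
  refine (Nat.cast_le.2 (Finset.card_le_card (primesInHasse_subset_Ioc hN))).trans
    ((card_filter_prime_Ioc_le (by omega : 1 ≤ y) _ _).trans ?_)
  have h1 := log_le_two_mul_squarefreeSum y
  have h2 : 0 < Real.log y := Real.log_pos (by exact_mod_cast hy)
  have h3 : Real.log y ≤ Real.log (y + 1) := Real.log_le_log (by positivity) (by linarith)
  have h4 : (0 : ℝ) ≤ ((2 * (4 * N).sqrt + 1 : ℕ) : ℝ) := Nat.cast_nonneg _
  have h5 : ((2 * (4 * N).sqrt + 1 : ℕ) : ℝ) / squarefreeSum y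
      ≤ 2 * ((2 * (4 * N).sqrt + 1 : ℕ) : ℝ) / Real.log y := by
    rw [div_le_div_iff₀ (by linarith) h2]
    nlinarith
  linarith

set_option maxHeartbeats 1000000 in
lemma exists_sum_HKr_le_of_le : ∃ C : ℝ, 0 < C ∧ ∀ N : ℕ, 16 ≤ Real.log N →
    Real.log N ^ 2 + 2 ≤ (N : ℝ) ^ (1 / 8 : ℝ) →
    ∑ p ∈ primesInHasse N, HKr (DN N p)
      ≤ C * ((N : ℝ) * Real.log (Real.log N) / Real.log N) := by
  obtain ⟨C₁, hC₁, h₁⟩ := exists_HKr_le_mul_log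
  obtain ⟨C₂, hC₂, h₂⟩ := exists_HKr_mul_log_le_of_sum_sqrtDev_le 32
  refine ⟨1944 * C₂ + 22 * C₁, by positivity, fun N hl hu => ?_⟩
  have hN0 : 0 < N := by
    rcases Nat.eq_zero_or_pos N with h | h
    · norm_num [h] at hl
    · exact h
  have hN0' : (0 : ℝ) < N := by exact_mod_cast hN0
  have hN4 : 4 ≤ N := by
    have := Real.log_le_sub_one_of_pos hN0'
    have : (4 : ℝ) ≤ N := by linarith
    exact_mod_cast this
  obtain ⟨hy1, hy2⟩ := log_natFloor_rpow_bounds hl (by nlinarith)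
  obtain ⟨hs1, hs2⟩ := sqrt_four_mul_bounds (N := N) (by omega)
  have hz1 := log_natCeil_sq_le (l := Real.log N) (by linarith)
  have hz2 : Real.log N ^ 2 ≤ ⌈Real.log N ^ 2⌉₊ := Nat.le_ceil _
  have hlogr : Real.log √(N : ℝ) = Real.log N / 2 := Real.log_sqrt (Nat.cast_nonneg N)
  have hrr : √(N : ℝ) * √(N : ℝ) = N := Real.mul_self_sqrt (Nat.cast_nonneg N)
  have hru : √(N : ℝ) = ((N : ℝ) ^ (1 / 8 : ℝ)) ^ 4 := by
    rw [Real.sqrt_eq_rpow, ← Real.rpow_natCast, ← Real.rpow_mul hN0'.le]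
    norm_num
  have hyu : (⌊(N : ℝ) ^ (1 / 8 : ℝ)⌋₊ : ℝ) ≤ (N : ℝ) ^ (1 / 8 : ℝ) :=
    Nat.floor_le (by positivity)
  have hyge : 2 ≤ ⌊(N : ℝ) ^ (1 / 8 : ℝ)⌋₊ := Nat.le_floor (by push_cast; nlinarith)
  set l := Real.log N with hl_def
  set u := (N : ℝ) ^ (1 / 8 : ℝ)
  set r := √(N : ℝ)
  set y := ⌊u⌋₊
  set z := ⌈l ^ 2⌉₊
  set s := (4 * N).sqrt with hs_def
  have hl0 : 0 < l := by linarith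
  have hu0 : 0 < u := by nlinarith
  have hr0 : 0 < r := by rw [hru]; positivity
  have hs0 : (0 : ℝ) < s := by linarith
  have hll : 1 ≤ Real.log l := by
    rw [Real.le_log_iff_exp_le hl0]
    linarith [Real.exp_one_lt_d9]
  have hlog4 : Real.log 4 ≤ 2 := by
    rw [show (4 : ℝ) = 2 ^ 2 by norm_num, Real.log_pow]
    norm_num
    linarith [Real.log_two_lt_d9]
  have hlogs1 : l / 2 ≤ Real.log s := hlogr ▸ Real.log_le_log hr0 hs1
  have hlogs2 : Real.log s ≤ l := by
    have h := Real.log_le_log hs0 hs2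
    rw [Real.log_mul (by norm_num) hr0.ne', hlogr] at h
    linarith [Real.log_two_lt_d9]
  have hzge : 2 ≤ z := by
    have : (2 : ℝ) ≤ z := by nlinarith
    exact_mod_cast this
  have hlM : Real.log (4 * N : ℕ) ≤ Real.log 2 * z := by
    push_cast
    rw [Real.log_mul (by norm_num) hN0'.ne', ← hl_def]
    have := Real.log_two_gt_d9
    nlinarith
  have hly : Real.log s + Real.log 4 ≤ 32 * Real.log y := by linarith
  have hs2' : 2 ≤ s := by
    rw [hs_def, Nat.le_sqrt]
    omega
  have hul : l ^ 2 ≤ u := by linarith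
  have hT : ((2 * s + 1 : ℕ) : ℝ) ≤ 5 * r := by
    push_cast
    have : 1 ≤ r := by
      rw [hru]
      exact one_le_pow₀ (by nlinarith)
    linarith
  have hu2 : u ^ 2 * l ^ 2 ≤ r := by
    rw [hru]
    calc u ^ 2 * l ^ 2 ≤ u ^ 2 * u ^ 2 := by gcongr; nlinarith
      _ = u ^ 4 := by ring
  have hu2' : u ^ 2 ≤ r / l ^ 2 := by rwa [le_div_iff₀ (by positivity)]
  have hy2' : (y : ℝ) ^ 2 ≤ u ^ 2 := by gcongr
  have hP : ((primesInHasse N).card : ℝ) ≤ 162 * r / l := by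
    refine (card_primesInHasse_le hN4 hyge).trans ?_
    have h1 : 2 * ((2 * s + 1 : ℕ) : ℝ) / Real.log y ≤ 160 * r / l := by
      calc 2 * ((2 * s + 1 : ℕ) : ℝ) / Real.log y ≤ 2 * (5 * r) / (l / 16) := by gcongr
        _ = 160 * r / l := by ring
    have h2 : r / l ^ 2 ≤ r / l := by
      gcongr
      nlinarith
    have h3 : (y : ℝ) ≤ u ^ 2 := by nlinarith
    have h4 : 162 * r / l = 160 * r / l + r / l + r / l := by ring
    linarith
  set Q := y.primesLE.filter (fun q => z < q ∧ ¬ (q : ℤ) ∣ (4 * N : ℕ)) with hQ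
  set E := (primesInHasse N).filter fun p : ℕ =>
    1 < ∑ q ∈ Q, sqrtDev (4 * N : ℕ) q (((p : ℤ) - N - 1 : ℤ) : ZMod q) / q with hE_def
  have hE : (E.card : ℝ) ≤ 11 * r / l ^ 2 := by
    refine (card_exceptional_le (N := N) (y := y) hzge).trans ?_
    have h1 : 2 * ((2 * s + 1 : ℕ) : ℝ) / z ≤ 10 * r / l ^ 2 := by
      calc 2 * ((2 * s + 1 : ℕ) : ℝ) / z ≤ 2 * (5 * r) / l ^ 2 := by gcongr
        _ = 10 * r / l ^ 2 := by ring
    have h4 : 11 * r / l ^ 2 = 10 * r / l ^ 2 + r / l ^ 2 := by ring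
    linarith
  have hterm : ∀ p ∈ primesInHasse N, HKr (DN N p) ≤
      12 * C₂ * r * Real.log l + if 1 < ∑ q ∈ Q,
        sqrtDev (4 * N : ℕ) q (((p : ℤ) - N - 1 : ℤ) : ZMod q) / q then 2 * C₁ * r * l else 0 := by
    intro p hp
    have hpb := (mem_primesInHasse_bounds hp).2
    rw [DN_eq]
    split_ifs with hexc
    · have h := h₁ (4 * N) (((p : ℤ) - N - 1) ^ 2 - (4 * N : ℕ)) hs2'
        (by linarith [sq_nonneg ((p : ℤ) - N - 1)])
      have h2 : C₁ * (s : ℝ) * Real.log s ≤ C₁ * (2 * r) * l := by gcongr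
      have h3 : 0 ≤ 12 * C₂ * r * Real.log l := by positivity
      linarith
    · have h := h₂ (4 * N) z y ((p : ℤ) - N - 1) hzge hyge (by omega) (by push_cast; exact hpb)
        hlM hly (not_lt.1 hexc)
      have h0 : (0 : ℝ) ≤ Real.log y := by linarith
      have hz0 : (0 : ℝ) ≤ Real.log z := Real.log_natCast_nonneg z
      have h2 : C₂ * (s : ℝ) * Real.log z * Real.log y
          ≤ C₂ * (2 * r) * (3 * Real.log l) * l := by gcongr
      have hs0' : 0 < Real.log s := by linarith
      rw [add_zero]
      refine le_of_mul_le_mul_right ((h.trans h2).trans ?_) hs0'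
      have h5 : 0 ≤ 12 * C₂ * r * Real.log l := by positivity
      nlinarith
  calc ∑ p ∈ primesInHasse N, HKr (DN N p)
      ≤ (primesInHasse N).card * (12 * C₂ * r * Real.log l) + E.card * (2 * C₁ * r * l) := by
        refine (Finset.sum_le_sum hterm).trans (le_of_eq ?_)
        rw [Finset.sum_add_distrib, ← Finset.sum_filter, Finset.sum_const, Finset.sum_const,
          nsmul_eq_mul, nsmul_eq_mul]
    _ ≤ (162 * r / l) * (12 * C₂ * r * Real.log l) + (11 * r / l ^ 2) * (2 * C₁ * r * l) := by
        gcongr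
    _ = (r * r) / l * (1944 * C₂ * Real.log l + 22 * C₁) := by
        field_simp
        ring
    _ ≤ N / l * (1944 * C₂ * Real.log l + 22 * C₁ * Real.log l) := by
        have h22 : 22 * C₁ ≤ 22 * C₁ * Real.log l :=
          le_mul_of_one_le_right (by positivity) hll
        rw [hrr]
        exact mul_le_mul_of_nonneg_left (by linarith) (by positivity)
    _ = _ := by ring

/-- Proposition 1 (`upper bound for H on avg`):
∑_{N⁻ < p < N⁺} H(D_N(p)) ≪ N·(log log N)/(log N). -/
theorem sum_kronecker_class_number_bound : ∃ C : ℝ, 0 < C ∧ ∀ N : ℕ, 3 ≤ N →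
    ∑ p ∈ primesInHasse N, HKr (DN N p)
      ≤ C * ((N : ℝ) * Real.log (Real.log N) / Real.log N) := by
  obtain ⟨C, hC, h⟩ := exists_sum_HKr_le_of_le
  obtain ⟨N₀, hN₀⟩ := Filter.eventually_atTop.1 eventually_log_sq_le_rpow
  set R : ℕ → ℝ := fun N => (N : ℝ) * Real.log (Real.log N) / Real.log N with hR
  set S : ℕ → ℝ := fun N => ∑ p ∈ primesInHasse N, HKr (DN N p) with hS
  have hsum : 0 ≤ ∑ n ∈ Finset.range N₀, |S n / R n| := Finset.sum_nonneg fun _ _ => abs_nonneg _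
  refine ⟨C + ∑ n ∈ Finset.range N₀, |S n / R n|, by positivity, fun N hN => ?_⟩
  change S N ≤ _ * R N
  have hl : 1 < Real.log N := by
    rw [Real.lt_log_iff_exp_lt (by positivity)]
    have : (3 : ℝ) ≤ N := by exact_mod_cast hN
    linarith [Real.exp_one_lt_d9]
  have hRpos : 0 < R N := by
    have := Real.log_pos hl
    have : (0 : ℝ) < N := by positivity
    simp only [hR]
    positivity
  rcases le_or_gt N₀ N with hle | hlt
  · obtain ⟨h1, h2⟩ := hN₀ N hle
    exact (h N h1 h2).trans (mul_le_mul_of_nonneg_right (by linarith) hRpos.le)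
  · rw [← div_le_iff₀ hRpos]
    have h1 := Finset.single_le_sum (f := fun n => |S n / R n|) (fun _ _ => abs_nonneg _)
      (Finset.mem_range.2 hlt)
    have h2 := le_abs_self (S N / R N)
    exact h2.trans (h1.trans (by linarith))
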